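/- arXiv:1705.04587 — 2 statements merged into one kernel-verified Lean document; each statement's English description precedes it below -/
import Mathlib

section
/- In every normal-form feasible schedule of the constructed instance with makespan W, for every job B' ∈ B the following counts at the start time of B' coincide: #_{B'} c − #_{B'} {λ_2} = #_{B'} A − #_{B'} {λ_2} = #_{B'} β = #_{B'} a = #_{B'} b. -/
/-- Jobs of the instance constructed from a 3-Partition instance with parameter `z`. -/
inductive Job (z : ℕ) : Type
  | JA (i : Fin (z+1))
  | JB (i : Fin (z+1))
  | Ja (i : Fin z)
  | Jb (i : Fin z)
  | Jc (j : Fin (z+1))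
  | Jα (i : Fin z)
  | Jβ (i : Fin z)
  | Jγ (j : Fin z)
  | Jδ (j : Fin z)
  | Jl1
  | Jl2
  | Jpart (i : Fin (3*z))
  deriving DecidableEq, Fintype

/-- Processing times of the constructed jobs (`γ_j`, `δ_j` use index `j ∈ {1,…,z}`,
represented by `j.val + 1` for `j : Fin z`). -/
def pJob (z D : ℕ) (ι : Fin (3*z) → ℕ) : Job z → ℕ
  | .JA _ => D^2
  | .JB _ => D^3
  | .Ja _ => D^4 + D^6 + 3*z*D^7
  | .Jb _ => D^5 + D^6 + 3*z*D^7
  | .Jc j => (z + j.val)*D^7 + D^8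
  | .Jα _ => D^3 + D^5 + 4*z*D^7 + D^8
  | .Jβ _ => D^2 + D^4 + (4*z-1)*D^7 + D^8
  | .Jγ j => D^5 + (3*z - (j.val+1))*D^7 - D
  | .Jδ j => D^4 + (3*z - (j.val+1))*D^7
  | .Jl1 => D^3 + z*D^7 + D^8
  | .Jl2 => D^2 + 2*z*D^7 + D^8
  | .Jpart i => ι i

/-- Machine requirements of the constructed jobs. -/
def qJob (z : ℕ) : Job z → ℕ
  | .JA _ => 3
  | .JB _ => 3
  | .Ja _ => 2
  | .Jb _ => 2
  | .Jc _ => 2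
  | _ => 1

/-- Feasibility of a schedule `(σ, ρ)` on machines `{1,…,m}`: every job gets `q j`
machines among `{1,…,m}`, and jobs sharing a machine have disjoint half-open intervals. -/
def Feasible {J : Type} (m : ℕ) (p q : J → ℕ) (σ : J → ℕ) (ρ : J → Finset ℕ) : Prop :=
  (∀ j, ρ j ⊆ Finset.Icc 1 m) ∧ (∀ j, (ρ j).card = q j) ∧
  (∀ j j', j ≠ j' → (ρ j ∩ ρ j').Nonempty →
    σ j + p j ≤ σ j' ∨ σ j' + p j' ≤ σ j)

/-- Makespan of a schedule. -/
def makespan {J : Type} [Fintype J] (p σ : J → ℕ) : ℕ :=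
  Finset.univ.sup fun j => σ j + p j

/-- The target makespan `W`. -/
def Wval (z D : ℕ) : ℕ :=
  (z+1)*(D^2 + D^3 + D^8) + z*(D^4 + D^5 + D^6) + z*(7*z+1)*D^7

/-- The 3-Partition instance `ι` is a Yes-instance. -/
def IsYes (z D : ℕ) (ι : Fin (3*z) → ℕ) : Prop :=
  ∃ f : Fin (3*z) → Fin z,
    ∀ k : Fin z, ∑ i ∈ Finset.univ.filter (fun i => f i = k), ι i = D

/-- Jobs processed on machine 1 in a normal-form schedule: `A ∪ a ∪ α ∪ {λ₁}`. -/
def M1Jobs {z : ℕ} : Job z → Prop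
  | .JA _ => True
  | .Ja _ => True
  | .Jα _ => True
  | .Jl1 => True
  | _ => False

/-- Jobs processed on machine 4 in a normal-form schedule: `B ∪ b ∪ β ∪ {λ₂}`. -/
def M4Jobs {z : ℕ} : Job z → Prop
  | .JB _ => True
  | .Jb _ => True
  | .Jβ _ => True
  | .Jl2 => True
  | _ => False

/-- Jobs processed on both machines 2 and 3: `A ∪ B ∪ c`. -/
def BothM23 {z : ℕ} : Job z → Prop
  | .JA _ => True
  | .JB _ => True
  | .Jc _ => True
  | _ => False

/-- Jobs processed on exactly one of machines 2 and 3: `a ∪ b ∪ γ ∪ δ ∪ P`. -/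
def OneM23 {z : ℕ} : Job z → Prop
  | .Ja _ => True
  | .Jb _ => True
  | .Jγ _ => True
  | .Jδ _ => True
  | .Jpart _ => True
  | _ => False

/-- Normal form of a schedule of the constructed instance. -/
def NormalForm {z : ℕ} (ρ : Job z → Finset ℕ) : Prop :=
  (∀ j, 1 ∈ ρ j ↔ M1Jobs j) ∧
  (∀ j, 4 ∈ ρ j ↔ M4Jobs j) ∧
  (∀ j, BothM23 j → 2 ∈ ρ j ∧ 3 ∈ ρ j) ∧
  (∀ j, OneM23 j → ((2 ∈ ρ j) ↔ ¬ (3 ∈ ρ j)))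

/-- `cnt p σ S i` = number of jobs of `S` finishing no later than the start of `i`
(the quantity `#ᵢ S`). -/
def cnt {z : ℕ} (p σ : Job z → ℕ) (S : Finset (Job z)) (i : Job z) : ℕ :=
  (S.filter fun j => σ j + p j ≤ σ i).card

def sA (z : ℕ) : Finset (Job z) := Finset.univ.image Job.JA
def sB (z : ℕ) : Finset (Job z) := Finset.univ.image Job.JB
def sa (z : ℕ) : Finset (Job z) := Finset.univ.image Job.Ja
def sb (z : ℕ) : Finset (Job z) := Finset.univ.image Job.Jb
def sc (z : ℕ) : Finset (Job z) := Finset.univ.image Job.Jc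
def sα (z : ℕ) : Finset (Job z) := Finset.univ.image Job.Jα
def sβ (z : ℕ) : Finset (Job z) := Finset.univ.image Job.Jβ
def sγ (z : ℕ) : Finset (Job z) := Finset.univ.image Job.Jγ
def sδ (z : ℕ) : Finset (Job z) := Finset.univ.image Job.Jδ


namespace CB

lemma pack {J : Type} (S : Finset J) (σ p : J → ℕ)
    (hd : ∀ j ∈ S, ∀ j' ∈ S, j ≠ j' → σ j + p j ≤ σ j' ∨ σ j' + p j' ≤ σ j)
    (lo hi : ℕ) (hlh : lo ≤ hi) (hb : ∀ j ∈ S, lo ≤ σ j ∧ σ j + p j ≤ hi) :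
    lo + ∑ j ∈ S, p j ≤ hi := by
  classical
  have h1 : (S.biUnion fun j => Finset.Ico (σ j) (σ j + p j)).card = ∑ j ∈ S, p j := by
    rw [Finset.card_biUnion]
    · simp
    · intro j hj j' hj' hne
      simp only [Function.onFun]
      rw [Finset.disjoint_left]
      intro x hx hx'
      rw [Finset.mem_Ico] at hx hx'
      rcases hd j hj j' hj' hne with h | h <;> omega
  have h2 : (S.biUnion fun j => Finset.Ico (σ j) (σ j + p j)) ⊆ Finset.Ico lo hi := by
    intro x hx
    rw [Finset.mem_biUnion] at hx
    obtain ⟨j, hj, hx⟩ := hx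
    have := hb j hj
    rw [Finset.mem_Ico] at hx ⊢
    omega
  have h3 := Finset.card_le_card h2
  rw [h1, Nat.card_Ico] at h3
  omega

lemma load {J : Type} (S : Finset J) (σ p : J → ℕ) (W t : ℕ)
    (hd : ∀ j ∈ S, ∀ j' ∈ S, j ≠ j' → σ j + p j ≤ σ j' ∨ σ j' + p j' ≤ σ j)
    (hend : ∀ j ∈ S, σ j + p j ≤ W) (htot : ∑ j ∈ S, p j = W) (ht : t ≤ W)
    (hbd : ∀ j ∈ S, σ j + p j ≤ t ∨ t ≤ σ j) :
    ∑ j ∈ S.filter (fun j => σ j + p j ≤ t), p j = t := by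
  have h1 := pack (S.filter (fun j => σ j + p j ≤ t)) σ p
    (fun j hj j' hj' => hd j (Finset.mem_filter.1 hj).1 j' (Finset.mem_filter.1 hj').1) 0 t (by omega)
    (fun j hj => ⟨by omega, (Finset.mem_filter.1 hj).2⟩)
  have h2 := pack (S.filter (fun j => ¬ σ j + p j ≤ t)) σ p
    (fun j hj j' hj' => hd j (Finset.mem_filter.1 hj).1 j' (Finset.mem_filter.1 hj').1) t W ht
    (fun j hj => by
      have := Finset.mem_filter.1 hj
      have := hbd j this.1
      have := hend j (Finset.mem_filter.1 hj).1
      omega)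
  have h3 := Finset.sum_filter_add_sum_filter_not S (fun j => σ j + p j ≤ t) p
  omega

def jobEquiv (z : ℕ) : Job z ≃ (Fin (z+1) ⊕ Fin (z+1) ⊕ Fin z ⊕ Fin z ⊕ Fin (z+1) ⊕ Fin z ⊕ Fin z ⊕
    Fin z ⊕ Fin z ⊕ Unit ⊕ Unit ⊕ Fin (3*z)) where
  toFun
    | .JA i => .inl i
    | .JB i => .inr (.inl i)
    | .Ja i => .inr (.inr (.inl i))
    | .Jb i => .inr (.inr (.inr (.inl i)))
    | .Jc i => .inr (.inr (.inr (.inr (.inl i))))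
    | .Jα i => .inr (.inr (.inr (.inr (.inr (.inl i)))))
    | .Jβ i => .inr (.inr (.inr (.inr (.inr (.inr (.inl i))))))
    | .Jγ i => .inr (.inr (.inr (.inr (.inr (.inr (.inr (.inl i)))))))
    | .Jδ i => .inr (.inr (.inr (.inr (.inr (.inr (.inr (.inr (.inl i))))))))
    | .Jl1 => .inr (.inr (.inr (.inr (.inr (.inr (.inr (.inr (.inr (.inl ())))))))))
    | .Jl2 => .inr (.inr (.inr (.inr (.inr (.inr (.inr (.inr (.inr (.inr (.inl ()))))))))))
    | .Jpart i => .inr (.inr (.inr (.inr (.inr (.inr (.inr (.inr (.inr (.inr (.inr i))))))))))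
  invFun
    | .inl i => .JA i
    | .inr (.inl i) => .JB i
    | .inr (.inr (.inl i)) => .Ja i
    | .inr (.inr (.inr (.inl i))) => .Jb i
    | .inr (.inr (.inr (.inr (.inl i)))) => .Jc i
    | .inr (.inr (.inr (.inr (.inr (.inl i))))) => .Jα i
    | .inr (.inr (.inr (.inr (.inr (.inr (.inl i)))))) => .Jβ i
    | .inr (.inr (.inr (.inr (.inr (.inr (.inr (.inl i))))))) => .Jγ i
    | .inr (.inr (.inr (.inr (.inr (.inr (.inr (.inr (.inl i)))))))) => .Jδ i
    | .inr (.inr (.inr (.inr (.inr (.inr (.inr (.inr (.inr (.inl _))))))))) => .Jl1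
    | .inr (.inr (.inr (.inr (.inr (.inr (.inr (.inr (.inr (.inr (.inl _)))))))))) => .Jl2
    | .inr (.inr (.inr (.inr (.inr (.inr (.inr (.inr (.inr (.inr (.inr i)))))))))) => .Jpart i
  left_inv := by intro j; cases j <;> rfl
  right_inv := by rintro (_|_|_|_|_|_|_|_|_|_|_|_) <;> rfl

lemma sum_job {z : ℕ} (f : Job z → ℤ) :
    ∑ j, f j = ∑ i, f (.JA i) + ∑ i, f (.JB i) + ∑ i, f (.Ja i) + ∑ i, f (.Jb i) + ∑ i, f (.Jc i)
      + ∑ i, f (.Jα i) + ∑ i, f (.Jβ i) + ∑ i, f (.Jγ i) + ∑ i, f (.Jδ i) + f .Jl1 + f .Jl2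
      + ∑ i, f (.Jpart i) := by
  rw [← Equiv.sum_comp (jobEquiv z).symm f]
  simp only [Fintype.sum_sum_type, Finset.univ_unique, Finset.sum_singleton]
  simp only [jobEquiv, Equiv.coe_fn_symm_mk]
  ring

/-- digit extraction -/
lemma digit1 (D x y : ℤ) (h : x + D * y = 0) (h1 : -D < x) (h2 : x < D) : x = 0 ∧ y = 0 := by
  have hD : 0 < D := by linarith
  have hy : y = 0 := by
    rcases lt_trichotomy y 0 with h' | h' | h'
    · nlinarith
    · exact h'
    · nlinarith
  subst hy
  exact ⟨by linarith, rfl⟩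

lemma digits (D l d2 d3 d4 d5 d6 d7 d8 : ℤ)
    (h : l + d2*D^2 + d3*D^3 + d4*D^4 + d5*D^5 + d6*D^6 + d7*D^7 + d8*D^8 = 0)
    (hl : -D^2 < l ∧ l < D^2) (h2 : -D < d2 ∧ d2 < D) (h3 : -D < d3 ∧ d3 < D)
    (h4 : -D < d4 ∧ d4 < D) (h5 : -D < d5 ∧ d5 < D) (h6 : -D < d6 ∧ d6 < D)
    (h7 : -D < d7 ∧ d7 < D) :
    l = 0 ∧ d2 = 0 ∧ d3 = 0 ∧ d4 = 0 ∧ d5 = 0 ∧ d6 = 0 ∧ d7 = 0 ∧ d8 = 0 := by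
  obtain ⟨a0, b0⟩ := digit1 (D^2) l (d2 + D*(d3 + D*(d4+D*(d5+D*(d6+D*(d7+D*d8)))))) (by linarith) hl.1 hl.2
  obtain ⟨a1, b1⟩ := digit1 D _ _ b0 h2.1 h2.2
  obtain ⟨a2, b2⟩ := digit1 D _ _ b1 h3.1 h3.2
  obtain ⟨a3, b3⟩ := digit1 D _ _ b2 h4.1 h4.2
  obtain ⟨a4, b4⟩ := digit1 D _ _ b3 h5.1 h5.2
  obtain ⟨a5, b5⟩ := digit1 D _ _ b4 h6.1 h6.2
  obtain ⟨a6, b6⟩ := digit1 D _ _ b5 h7.1 h7.2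
  exact ⟨a0, a1, a2, a3, a4, a5, a6, b6⟩

lemma single_idx {k : ℕ} (f : Fin k → ℤ) (n : ℤ) (h0 : ∀ i, 0 ≤ f i) (h1 : ∑ i, f i = 1)
    (hn : ∑ i, f i * ((i.val:ℤ) + 1) = n) : ∃ i, 0 < f i ∧ (i.val : ℤ) + 1 = n := by
  have : ∃ i, 0 < f i := by
    by_contra hc
    push Not at hc
    have : ∑ i, f i ≤ 0 := Finset.sum_nonpos (fun i _ => hc i)
    omega
  obtain ⟨i, hi⟩ := this
  have hr := Finset.add_sum_erase Finset.univ f (Finset.mem_univ i)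
  have hnn : 0 ≤ ∑ x ∈ Finset.univ.erase i, f x := Finset.sum_nonneg (fun x _ => h0 x)
  have hz : ∑ x ∈ Finset.univ.erase i, f x = 0 := by omega
  have hfi : f i = 1 := by omega
  have hz' := (Finset.sum_eq_zero_iff_of_nonneg (fun x _ => h0 x)).1 hz
  refine ⟨i, hi, ?_⟩
  rw [← hn, ← Finset.add_sum_erase Finset.univ _ (Finset.mem_univ i), hfi,
    Finset.sum_eq_zero (fun x hx => by rw [hz' x hx, zero_mul])]
  ring

/-- completion indicator on machine `m` at time `t` -/
def ee {z : ℕ} (p σ : Job z → ℕ) (ρ : Job z → Finset ℕ) (m t : ℕ) (j : Job z) : ℤ :=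
  if m ∈ ρ j ∧ σ j + p j ≤ t then 1 else 0

section
variable {z : ℕ} (p σ : Job z → ℕ) (ρ : Job z → Finset ℕ)

lemma ee_nonneg (m t j) : 0 ≤ ee p σ ρ m t j := by unfold ee; split_ifs <;> simp
lemma ee_le (m t j) : ee p σ ρ m t j ≤ 1 := by unfold ee; split_ifs <;> simp
lemma ee_mono (m j) {s t : ℕ} (h : s ≤ t) : ee p σ ρ m s j ≤ ee p σ ρ m t j := by
  unfold ee; split_ifs <;> simp_all; omega
lemma ee_zero {m j} (t : ℕ) (h : m ∉ ρ j) : ee p σ ρ m t j = 0 := by simp [ee, h]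
lemma ee_start {m j} (h : 0 < p j) : ee p σ ρ m (σ j) j = 0 := by
  unfold ee; rw [if_neg]; omega
lemma ee_done {m t j} (hm : m ∈ ρ j) (h : σ j + p j ≤ t) : ee p σ ρ m t j = 1 := by
  unfold ee; rw [if_pos ⟨hm, h⟩]

/-- count of a family -/
def NN {k : ℕ} (X : Fin k → Job z) (m t : ℕ) : ℤ := ∑ i, ee p σ ρ m t (X i)

lemma NN_nonneg {k} (X : Fin k → Job z) (m t) : 0 ≤ NN p σ ρ X m t :=
  Finset.sum_nonneg (fun i _ => ee_nonneg ..)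
lemma NN_le {k} (X : Fin k → Job z) (m t) : NN p σ ρ X m t ≤ k := by
  unfold NN
  calc _ ≤ ∑ i : Fin k, (1:ℤ) := Finset.sum_le_sum (fun i _ => ee_le ..)
    _ = k := by simp
lemma NN_mono {k} (X : Fin k → Job z) (m) {s t : ℕ} (h : s ≤ t) :
    NN p σ ρ X m s ≤ NN p σ ρ X m t := Finset.sum_le_sum (fun i _ => ee_mono _ _ _ _ _ h)
lemma NN_lt {k} (X : Fin k → Job z) (m) (i : Fin k) (hm : m ∈ ρ (X i)) (hp : 0 < p (X i)) {t : ℕ}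
    (h : σ (X i) + p (X i) ≤ t) :
    NN p σ ρ X m (σ (X i)) + 1 ≤ NN p σ ρ X m t := by
  have : NN p σ ρ X m (σ (X i)) < NN p σ ρ X m t := by
    refine Finset.sum_lt_sum (fun j _ => ee_mono _ _ _ _ _ (by omega)) ⟨i, Finset.mem_univ _, ?_⟩
    rw [ee_start _ _ _ hp, ee_done _ _ _ hm h]; norm_num
  omega
lemma NN_lt_card {k} (X : Fin k → Job z) (m) (i : Fin k) (hp : 0 < p (X i)) {t : ℕ}
    (h : t ≤ σ (X i)) : NN p σ ρ X m t + 1 ≤ k := by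
  have h1 : NN p σ ρ X m t < ∑ i : Fin k, (1:ℤ) := by
    refine Finset.sum_lt_sum (fun j _ => ee_le ..) ⟨i, Finset.mem_univ _, ?_⟩
    unfold ee; rw [if_neg]; norm_num; omega
  simp at h1
  omega

lemma NN_eq_pt {k} (X : Fin k → Job z) (m) {s t : ℕ} (hst : s ≤ t)
    (h : NN p σ ρ X m s = NN p σ ρ X m t) (i) : ee p σ ρ m s (X i) = ee p σ ρ m t (X i) :=
  (Finset.sum_eq_sum_iff_of_le (fun i _ => ee_mono p σ ρ m (X i) hst)).1 h i (Finset.mem_univ _)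

lemma rank_ex {k} (X : Fin k → Job z) (m) (hm : ∀ i, m ∈ ρ (X i)) (hp : ∀ i, 0 < p (X i))
    (hc : ∀ i i', i ≠ i' → σ (X i) + p (X i) ≤ σ (X i') ∨ σ (X i') + p (X i') ≤ σ (X i))
    (r : ℤ) (h0 : 0 ≤ r) (hr : r < k) : ∃ i, NN p σ ρ X m (σ (X i)) = r := by
  have hlt : ∀ i, (NN p σ ρ X m (σ (X i))).toNat < k := fun i => by
    have := NN_lt_card p σ ρ X m i (hp i) le_rfl
    have := NN_nonneg p σ ρ X m (σ (X i))
    omega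
  let f : Fin k → Fin k := fun i => ⟨_, hlt i⟩
  have hinj : Function.Injective f := by
    intro i i' h
    by_contra hne
    have h' : (NN p σ ρ X m (σ (X i))).toNat = (NN p σ ρ X m (σ (X i'))).toNat := Fin.mk.inj h
    have := NN_nonneg p σ ρ X m (σ (X i))
    have := NN_nonneg p σ ρ X m (σ (X i'))
    rcases hc i i' hne with h1 | h1
    · have := NN_lt p σ ρ X m i (hm i) (hp i) h1
      omega
    · have := NN_lt p σ ρ X m i' (hm i') (hp i') h1
      omega
  obtain ⟨i, hi⟩ := (Finite.injective_iff_surjective.1 hinj) ⟨r.toNat, by omega⟩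
  refine ⟨i, ?_⟩
  have h' : (NN p σ ρ X m (σ (X i))).toNat = r.toNat := Fin.mk.inj hi
  have := NN_nonneg p σ ρ X m (σ (X i))
  omega

lemma cnt_eq {k} (X : Fin k → Job z) (hX : Function.Injective X) (m) (hm : ∀ i, m ∈ ρ (X i)) (j : Job z) :
    (cnt p σ (Finset.univ.image X) j : ℤ) = NN p σ ρ X m (σ j) := by
  unfold cnt NN
  rw [Finset.card_filter, Finset.sum_image (fun a _ b _ h => hX h)]
  push_cast
  refine Finset.sum_congr rfl (fun i _ => ?_)
  simp [ee, hm]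

end

structure HH (z D : ℕ) (ι : Fin (3*z) → ℕ) (σ : Job z → ℕ) (ρ : Job z → Finset ℕ) : Prop where
  hz : 0 < z
  hD : 4*z*(7*z+1) < D
  hsum : ∑ i, ι i = z * D
  feas : Feasible 4 (pJob z D ι) (qJob z) σ ρ
  hend : ∀ j, σ j + pJob z D ι j ≤ Wval z D
  nf : NormalForm ρ

section
variable {z D : ℕ} {ι : Fin (3*z) → ℕ} {σ : Job z → ℕ} {ρ : Job z → Finset ℕ}

local notation "ℰ" => ee (pJob z D ι) σ ρ
local notation "𝒩" => NN (pJob z D ι) σ ρ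

lemma gauss1 (n : ℕ) : 2 * ∑ i : Fin n, ((i.val:ℤ) + 1) = n * (n+1) := by
  induction n with
  | zero => simp
  | succ n ih => rw [Fin.sum_univ_castSucc, mul_add]; simp only [Fin.val_castSucc, Fin.val_last]; rw [ih]; push_cast; ring

lemma gauss0 (n : ℕ) : 2 * ∑ i : Fin (n+1), (i.val:ℤ) = n * (n+1) := by
  induction n with
  | zero => simp
  | succ n ih => rw [Fin.sum_univ_castSucc, mul_add]; simp only [Fin.val_castSucc, Fin.val_last]; rw [ih]; push_cast; ring

/-- weighted index sum -/
def JJ (p σ : Job z → ℕ) (ρ : Job z → Finset ℕ) (m t : ℕ) : ℤ :=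
  ∑ i, ee p σ ρ m t (.Jγ i) * ((i.val:ℤ)+1) + ∑ i, ee p σ ρ m t (.Jδ i) * ((i.val:ℤ)+1)
def SS (p σ : Job z → ℕ) (ρ : Job z → Finset ℕ) (m t : ℕ) : ℤ :=
  ∑ i, ee p σ ρ m t (.Jc i) * (i.val:ℤ)
def PP (p σ : Job z → ℕ) (ρ : Job z → Finset ℕ) (ι : Fin (3*z) → ℕ) (m t : ℕ) : ℤ :=
  ∑ i, ee p σ ρ m t (.Jpart i) * (ι i:ℤ)

local notation "𝒥" => JJ (pJob z D ι) σ ρ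
local notation "𝒮" => SS (pJob z D ι) σ ρ

lemma HH.mem_one (h : HH z D ι σ ρ) {j : Job z} {m : ℕ} (hm : m ∈ ρ j) (hq : qJob z j = 1) {m' : ℕ}
    (hne : m' ≠ m) : m' ∉ ρ j := by
  have := h.feas.2.1 j
  rw [hq, Finset.card_eq_one] at this
  obtain ⟨x, hx⟩ := this
  rw [hx, Finset.mem_singleton] at hm ⊢
  omega

lemma HH.a1 (h : HH z D ι σ ρ) (i) : 1 ∈ ρ (.Ja i) := (h.nf.1 _).2 trivial
lemma HH.A1 (h : HH z D ι σ ρ) (i) : 1 ∈ ρ (.JA i) := (h.nf.1 _).2 trivial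
lemma HH.α1 (h : HH z D ι σ ρ) (i) : 1 ∈ ρ (.Jα i) := (h.nf.1 _).2 trivial
lemma HH.l1 (h : HH z D ι σ ρ) : 1 ∈ ρ .Jl1 := (h.nf.1 _).2 trivial
lemma HH.b4 (h : HH z D ι σ ρ) (i) : 4 ∈ ρ (.Jb i) := (h.nf.2.1 _).2 trivial
lemma HH.B4 (h : HH z D ι σ ρ) (i) : 4 ∈ ρ (.JB i) := (h.nf.2.1 _).2 trivial
lemma HH.β4 (h : HH z D ι σ ρ) (i) : 4 ∈ ρ (.Jβ i) := (h.nf.2.1 _).2 trivial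
lemma HH.l2 (h : HH z D ι σ ρ) : 4 ∈ ρ .Jl2 := (h.nf.2.1 _).2 trivial
lemma HH.both (h : HH z D ι σ ρ) {m} (hm : m = 2 ∨ m = 3) {j} (hj : BothM23 j) : m ∈ ρ j := by
  have := h.nf.2.2.1 j hj
  rcases hm with rfl | rfl
  exacts [this.1, this.2]

lemma HH.F1 (h : HH z D ι σ ρ) (t : ℕ) :
    ∑ j, ℰ 1 t j * (pJob z D ι j : ℤ) =
      𝒩 .JA 1 t * D^2 + (𝒩 .Jα 1 t + ℰ 1 t .Jl1) * D^3 + 𝒩 .Ja 1 t * D^4 + 𝒩 .Jα 1 t * D^5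
      + 𝒩 .Ja 1 t * D^6 + (3*z*𝒩 .Ja 1 t + 4*z*𝒩 .Jα 1 t + z*ℰ 1 t .Jl1) * D^7
      + (𝒩 .Jα 1 t + ℰ 1 t .Jl1) * D^8 := by
  have h0 : ∀ j, ¬ M1Jobs j → ℰ 1 t j = 0 := fun j hj => ee_zero _ _ _ _ (fun h' => hj ((h.nf.1 j).1 h'))
  rw [sum_job]
  simp only [pJob, h0 (.JB _) (by simp [M1Jobs]), h0 (.Jb _) (by simp [M1Jobs]), h0 (.Jc _) (by simp [M1Jobs]),
    h0 (.Jβ _) (by simp [M1Jobs]), h0 (.Jγ _) (by simp [M1Jobs]), h0 (.Jδ _) (by simp [M1Jobs]),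
    h0 (.Jl2) (by simp [M1Jobs]), h0 (.Jpart _) (by simp [M1Jobs]), zero_mul, Finset.sum_const_zero,
    ← Finset.sum_mul]
  unfold NN
  push_cast
  ring

lemma HH.F4 (h : HH z D ι σ ρ) (t : ℕ) :
    ∑ j, ℰ 4 t j * (pJob z D ι j : ℤ) =
      (𝒩 .Jβ 4 t + ℰ 4 t .Jl2) * D^2 + 𝒩 .JB 4 t * D^3 + 𝒩 .Jβ 4 t * D^4 + 𝒩 .Jb 4 t * D^5
      + 𝒩 .Jb 4 t * D^6 + (3*z*𝒩 .Jb 4 t + (4*z-1)*𝒩 .Jβ 4 t + 2*z*ℰ 4 t .Jl2) * D^7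
      + (𝒩 .Jβ 4 t + ℰ 4 t .Jl2) * D^8 := by
  have h0 : ∀ j, ¬ M4Jobs j → ℰ 4 t j = 0 := fun j hj => ee_zero _ _ _ _ (fun h' => hj ((h.nf.2.1 j).1 h'))
  rw [sum_job]
  simp only [pJob, h0 (.JA _) (by simp [M4Jobs]), h0 (.Ja _) (by simp [M4Jobs]), h0 (.Jc _) (by simp [M4Jobs]),
    h0 (.Jα _) (by simp [M4Jobs]), h0 (.Jγ _) (by simp [M4Jobs]), h0 (.Jδ _) (by simp [M4Jobs]),
    h0 (.Jl1) (by simp [M4Jobs]), h0 (.Jpart _) (by simp [M4Jobs]), zero_mul, Finset.sum_const_zero,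
    ← Finset.sum_mul]
  unfold NN
  have hz := h.hz
  push_cast [show 1 ≤ 4 * z by omega]
  ring

lemma HH.Fm (h : HH z D ι σ ρ) (m t : ℕ) (hm : m = 2 ∨ m = 3) :
    ∑ j, ℰ m t j * (pJob z D ι j : ℤ) =
      (PP (pJob z D ι) σ ρ ι m t - D * 𝒩 .Jγ m t) + 𝒩 .JA m t * D^2 + 𝒩 .JB m t * D^3
      + (𝒩 .Ja m t + 𝒩 .Jδ m t) * D^4 + (𝒩 .Jb m t + 𝒩 .Jγ m t) * D^5
      + (𝒩 .Ja m t + 𝒩 .Jb m t) * D^6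
      + (3*z*(𝒩 .Ja m t + 𝒩 .Jb m t) + z * 𝒩 .Jc m t + 𝒮 m t + 3*z*(𝒩 .Jγ m t + 𝒩 .Jδ m t) - 𝒥 m t) * D^7
      + 𝒩 .Jc m t * D^8 := by
  have hα : ∀ i, ℰ m t (.Jα i) = 0 := fun i =>
    ee_zero _ _ _ _ (h.mem_one (h.α1 i) rfl (by omega))
  have hβ : ∀ i, ℰ m t (.Jβ i) = 0 := fun i =>
    ee_zero _ _ _ _ (h.mem_one (h.β4 i) rfl (by omega))
  have hl1 : ℰ m t .Jl1 = 0 := ee_zero _ _ _ _ (h.mem_one h.l1 rfl (by omega))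
  have hl2 : ℰ m t .Jl2 = 0 := ee_zero _ _ _ _ (h.mem_one h.l2 rfl (by omega))
  have hγ : ∀ i : Fin z, ((pJob z D ι (.Jγ i) : ℕ) : ℤ) = D^5 + (3*z - ((i.val:ℤ)+1)) * D^7 - D := by
    intro i
    have h1 : D ≤ D^5 := Nat.le_self_pow (by norm_num) D
    have h2 : i.val + 1 ≤ 3 * z := by have := i.2; omega
    simp only [pJob]
    rw [Nat.cast_sub (by omega)]
    push_cast [h2]
    ring
  have hδ : ∀ i : Fin z, ((pJob z D ι (.Jδ i) : ℕ) : ℤ) = D^4 + (3*z - ((i.val:ℤ)+1)) * D^7 := by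
    intro i
    have h2 : i.val + 1 ≤ 3 * z := by have := i.2; omega
    simp only [pJob]
    push_cast [h2]
    ring
  have sγ : ∑ i : Fin z, ℰ m t (.Jγ i) * ((pJob z D ι (.Jγ i) : ℕ) : ℤ) =
      𝒩 .Jγ m t * D^5 + 3*z*𝒩 .Jγ m t * D^7 - (∑ i : Fin z, ℰ m t (.Jγ i) * ((i.val:ℤ)+1)) * D^7
        - D * 𝒩 .Jγ m t := by
    unfold NN
    simp only [hγ, Finset.sum_mul, Finset.mul_sum, ← Finset.sum_add_distrib, ← Finset.sum_sub_distrib]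
    exact Finset.sum_congr rfl (fun i _ => by ring)
  have sδ : ∑ i : Fin z, ℰ m t (.Jδ i) * ((pJob z D ι (.Jδ i) : ℕ) : ℤ) =
      𝒩 .Jδ m t * D^4 + 3*z*𝒩 .Jδ m t * D^7 - (∑ i : Fin z, ℰ m t (.Jδ i) * ((i.val:ℤ)+1)) * D^7 := by
    unfold NN
    simp only [hδ, Finset.sum_mul, Finset.mul_sum, ← Finset.sum_add_distrib, ← Finset.sum_sub_distrib]
    exact Finset.sum_congr rfl (fun i _ => by ring)
  have sc : ∑ i : Fin (z+1), ℰ m t (.Jc i) * ((pJob z D ι (.Jc i) : ℕ) : ℤ) =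
      z * 𝒩 .Jc m t * D^7 + 𝒮 m t * D^7 + 𝒩 .Jc m t * D^8 := by
    unfold NN SS
    simp only [pJob, Finset.sum_mul, Finset.mul_sum, ← Finset.sum_add_distrib]
    exact Finset.sum_congr rfl (fun i _ => by push_cast; ring)
  rw [sum_job, sγ, sδ, sc]
  simp only [pJob, hα, hβ, hl1, hl2, zero_mul, Finset.sum_const_zero, ← Finset.sum_mul]
  unfold NN JJ PP
  push_cast
  ring

lemma HH.comp (h : HH z D ι σ ρ) {j j' : Job z} (hne : j ≠ j') {m} (hm : m ∈ ρ j) (hm' : m ∈ ρ j') :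
    σ j + pJob z D ι j ≤ σ j' ∨ σ j' + pJob z D ι j' ≤ σ j :=
  h.feas.2.2 j j' hne ⟨m, Finset.mem_inter.2 ⟨hm, hm'⟩⟩

lemma ee_split (h : HH z D ι σ ρ) (t) {j : Job z} (hj : OneM23 j) :
    ℰ 2 t j + ℰ 3 t j = if σ j + pJob z D ι j ≤ t then 1 else 0 := by
  have := h.nf.2.2.2 j hj
  by_cases h2 : 2 ∈ ρ j
  · have h3 := this.1 h2
    simp [ee, h2, h3]
  · have h3 : 3 ∈ ρ j := by tauto
    simp [ee, h2, h3]

lemma HH.split (h : HH z D ι σ ρ) {k} (X : Fin k → Job z) (hj : ∀ i, OneM23 (X i)) (m) (hm : ∀ i, m ∈ ρ (X i)) (t) :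
    𝒩 X 2 t + 𝒩 X 3 t = 𝒩 X m t := by
  unfold NN
  rw [← Finset.sum_add_distrib]
  refine Finset.sum_congr rfl (fun i _ => ?_)
  rw [ee_split h t (hj i)]
  simp [ee, hm]

lemma same {k} (X : Fin k → Job z) (m m') (hm : ∀ i, m ∈ ρ (X i)) (hm' : ∀ i, m' ∈ ρ (X i)) (t) :
    𝒩 X m t = 𝒩 X m' t := by
  unfold NN
  exact Finset.sum_congr rfl (fun i _ => by simp [ee, hm, hm'])

lemma HH.load_le (h : HH z D ι σ ρ) (m : ℕ) :
    ∑ j, ℰ m (Wval z D) j * (pJob z D ι j : ℤ) ≤ Wval z D := by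
  have h1 := pack (Finset.univ.filter (fun j => m ∈ ρ j)) σ (pJob z D ι)
    (fun j hj j' hj' hne => h.comp hne (Finset.mem_filter.1 hj).2 (Finset.mem_filter.1 hj').2)
    0 (Wval z D) (by omega) (fun j _ => ⟨by omega, h.hend j⟩)
  have h2 : ∑ j, ℰ m (Wval z D) j * (pJob z D ι j : ℤ)
      = ((∑ j ∈ Finset.univ.filter (fun j => m ∈ ρ j), pJob z D ι j : ℕ) : ℤ) := by
    rw [Finset.sum_filter]
    push_cast
    refine Finset.sum_congr rfl (fun j _ => ?_)
    by_cases hm : m ∈ ρ j <;> simp [ee, hm, h.hend j]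
  rw [h2]
  exact_mod_cast (by omega)

lemma HH.load_t (h : HH z D ι σ ρ) (m t : ℕ)
    (htot : ∑ j, ℰ m (Wval z D) j * (pJob z D ι j : ℤ) = Wval z D) (ht : t ≤ Wval z D)
    (hbd : ∀ j, m ∈ ρ j → σ j + pJob z D ι j ≤ t ∨ t ≤ σ j) :
    (t : ℤ) = ∑ j, ℰ m t j * (pJob z D ι j : ℤ) := by
  have h2 : ∑ j, ℰ m (Wval z D) j * (pJob z D ι j : ℤ)
      = ((∑ j ∈ Finset.univ.filter (fun j => m ∈ ρ j), pJob z D ι j : ℕ) : ℤ) := by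
    rw [Finset.sum_filter]
    push_cast
    refine Finset.sum_congr rfl (fun j _ => ?_)
    by_cases hm : m ∈ ρ j <;> simp [ee, hm, h.hend j]
  have h1 := load (Finset.univ.filter (fun j => m ∈ ρ j)) σ (pJob z D ι) (Wval z D) t
    (fun j hj j' hj' hne => h.comp hne (Finset.mem_filter.1 hj).2 (Finset.mem_filter.1 hj').2)
    (fun j _ => h.hend j) (by rw [h2] at htot; exact_mod_cast htot) ht
    (fun j hj => hbd j (Finset.mem_filter.1 hj).2)
  conv_lhs => rw [← h1]
  rw [Finset.filter_filter, Finset.sum_filter]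
  push_cast
  refine Finset.sum_congr rfl (fun j _ => ?_)
  by_cases hm : m ∈ ρ j ∧ σ j + pJob z D ι j ≤ t <;> simp [ee, hm]

lemma HH.NW (h : HH z D ι σ ρ) {k} (X : Fin k → Job z) (m) (hm : ∀ i, m ∈ ρ (X i)) :
    𝒩 X m (Wval z D) = k := by
  unfold NN
  simp [ee, hm, h.hend]

lemma HH.NW2 (h : HH z D ι σ ρ) {k} (X : Fin k → Job z) (hj : ∀ i, OneM23 (X i)) :
    𝒩 X 2 (Wval z D) + 𝒩 X 3 (Wval z D) = k := by
  unfold NN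
  rw [← Finset.sum_add_distrib]
  simp [ee_split h _ (hj _), h.hend]

lemma HH.tot1 (h : HH z D ι σ ρ) : ∑ j, ℰ 1 (Wval z D) j * (pJob z D ι j : ℤ) = Wval z D := by
  rw [h.F1, h.NW _ _ h.A1, h.NW _ _ h.a1, h.NW _ _ h.α1, ee_done _ _ _ h.l1 (h.hend _)]
  unfold Wval
  push_cast
  ring

lemma HH.tot4 (h : HH z D ι σ ρ) : ∑ j, ℰ 4 (Wval z D) j * (pJob z D ι j : ℤ) = Wval z D := by
  rw [h.F4, h.NW _ _ h.B4, h.NW _ _ h.b4, h.NW _ _ h.β4, ee_done _ _ _ h.l2 (h.hend _)]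
  unfold Wval
  push_cast
  ring

lemma HH.tot23 (h : HH z D ι σ ρ) : ∑ j, ℰ 2 (Wval z D) j * (pJob z D ι j : ℤ) +
   ∑ j, ℰ 3 (Wval z D) j * (pJob z D ι j : ℤ) = 2 * Wval z D := by
  rw [h.Fm _ _ (Or.inl rfl), h.Fm _ _ (Or.inr rfl)]
  have hb : ∀ {m}, m = 2 ∨ m = 3 → ∀ {j}, BothM23 j → m ∈ ρ j := fun hm _ hj => h.both hm hj
  rw [h.NW .JA 2 (fun i => h.both (by simp) trivial), h.NW .JA 3 (fun i => h.both (by simp) trivial),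
    h.NW .JB 2 (fun i => h.both (by simp) trivial), h.NW .JB 3 (fun i => h.both (by simp) trivial),
    h.NW .Jc 2 (fun i => h.both (by simp) trivial), h.NW .Jc 3 (fun i => h.both (by simp) trivial)]
  have ha := h.NW2 .Ja (fun _ => trivial)
  have hb := h.NW2 .Jb (fun _ => trivial)
  have hg := h.NW2 .Jγ (fun _ => trivial)
  have hd := h.NW2 .Jδ (fun _ => trivial)
  have hS : ∀ m, m = 2 ∨ m = 3 → 2 * 𝒮 m (Wval z D) = z * (z+1) := by
    intro m hm
    rw [← gauss0 z]
    unfold SS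
    congr 1
    refine Finset.sum_congr rfl (fun i _ => ?_)
    rw [ee_done _ _ _ (h.both hm (j := .Jc i) trivial) (h.hend _)]; ring
  have hJ : 𝒥 2 (Wval z D) + 𝒥 3 (Wval z D) = z * (z+1) := by
    have e1 : ∀ X : Fin z → Job z, (∀ i, OneM23 (X i)) → ∑ i, ℰ 2 (Wval z D) (X i) * ((i.val:ℤ)+1)
       + ∑ i, ℰ 3 (Wval z D) (X i) * ((i.val:ℤ)+1) = ∑ i : Fin z, ((i.val:ℤ)+1) := by
      intro X hX
      rw [← Finset.sum_add_distrib]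
      refine Finset.sum_congr rfl (fun i _ => ?_)
      rw [← add_mul, ee_split h _ (hX i), if_pos (h.hend _), one_mul]
    have e2 := e1 .Jγ (fun _ => trivial)
    have e3 := e1 .Jδ (fun _ => trivial)
    rw [← gauss1 z]
    unfold JJ
    linarith
  have hP : PP (pJob z D ι) σ ρ ι 2 (Wval z D) + PP (pJob z D ι) σ ρ ι 3 (Wval z D) = z * D := by
    have : (z * D : ℤ) = ∑ i, (ι i : ℤ) := by exact_mod_cast h.hsum.symm
    rw [this]
    unfold PP
    rw [← Finset.sum_add_distrib]
    refine Finset.sum_congr rfl (fun i _ => ?_)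
    rw [← add_mul, ee_split h _ (j := .Jpart i) trivial, if_pos (h.hend _), one_mul]
  have hS2 := hS 2 (by simp)
  have hS3 := hS 3 (by simp)
  unfold Wval at *
  push_cast
  generalize 𝒩 .Ja 2 _ = a2 at *
  generalize 𝒩 .Ja 3 _ = a3 at *
  generalize 𝒩 .Jb 2 _ = b2 at *
  generalize 𝒩 .Jb 3 _ = b3 at *
  generalize 𝒩 .Jγ 2 _ = g2 at *
  generalize 𝒩 .Jγ 3 _ = g3 at *
  generalize 𝒩 .Jδ 2 _ = d2 at *
  generalize 𝒩 .Jδ 3 _ = d3 at *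
  generalize 𝒮 2 _ = S2 at *
  generalize 𝒮 3 _ = S3 at *
  generalize 𝒥 2 _ = J2 at *
  generalize 𝒥 3 _ = J3 at *
  generalize PP _ _ _ _ 2 _ = P2 at *
  generalize PP _ _ _ _ 3 _ = P3 at *
  obtain rfl : a2 = z - a3 := by linarith
  obtain rfl : b2 = z - b3 := by linarith
  obtain rfl : g2 = z - g3 := by linarith
  obtain rfl : d2 = z - d3 := by linarith
  obtain rfl : P2 = z * D - P3 := by linarith
  obtain rfl : J2 = z * (z+1) - J3 := by linarith
  have : S2 + S3 = z * (z+1) := by linarith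
  obtain rfl : S2 = z * (z+1) - S3 := by linarith
  ring

lemma HH.totm (h : HH z D ι σ ρ) (m) (hm : m = 2 ∨ m = 3) :
    ∑ j, ℰ m (Wval z D) j * (pJob z D ι j : ℤ) = Wval z D := by
  have h1 := h.tot23
  have h2 := h.load_le 2
  have h3 := h.load_le 3
  rcases hm with rfl | rfl <;> linarith

def Bd (p σ : Job z → ℕ) (ρ : Job z → Finset ℕ) (m t : ℕ) : Prop :=
  ∀ j, m ∈ ρ j → σ j + p j ≤ t ∨ t ≤ σ j

lemma HH.bd_start (h : HH z D ι σ ρ) {j m} (hm : m ∈ ρ j) : Bd (pJob z D ι) σ ρ m (σ j) := by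
  intro j' hj'
  by_cases hne : j' = j
  · subst hne; right; exact le_rfl
  · rcases h.comp hne hj' hm with h1 | h1
    · left; exact h1
    · right; omega

lemma S_bd (m t : ℕ) : 0 ≤ 𝒮 m t ∧ 𝒮 m t ≤ z * (z+1) := by
  unfold SS
  constructor
  · exact Finset.sum_nonneg (fun i _ => mul_nonneg (ee_nonneg ..) (by positivity))
  · calc _ ≤ ∑ i : Fin (z+1), (z:ℤ) := Finset.sum_le_sum (fun i _ => by
          have h1 := ee_nonneg (pJob z D ι) σ ρ m t (.Jc i)
          have h2 := ee_le (pJob z D ι) σ ρ m t (.Jc i)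
          have h3 : (i.val:ℤ) ≤ z := by have := i.2; omega
          nlinarith)
      _ = _ := by simp; ring

lemma J_bd (m t : ℕ) : 0 ≤ 𝒥 m t ∧ 𝒥 m t ≤ z * (𝒩 .Jγ m t + 𝒩 .Jδ m t) := by
  unfold JJ NN
  constructor
  · exact add_nonneg (Finset.sum_nonneg (fun i _ => mul_nonneg (ee_nonneg ..) (by positivity)))
      (Finset.sum_nonneg (fun i _ => mul_nonneg (ee_nonneg ..) (by positivity)))
  · have key : ∀ X : Fin z → Job z, ∑ i, ℰ m t (X i) * ((i.val:ℤ)+1) ≤ z * ∑ i, ℰ m t (X i) := by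
      intro X
      rw [Finset.mul_sum]
      refine Finset.sum_le_sum (fun i _ => ?_)
      have h1 := ee_nonneg (pJob z D ι) σ ρ m t (X i)
      have h3 : (i.val:ℤ) + 1 ≤ z := by have := i.2; omega
      nlinarith
    rw [mul_add]
    exact add_le_add (key _) (key _)

lemma HH.P_bd (h : HH z D ι σ ρ) (m t : ℕ) : 0 ≤ PP (pJob z D ι) σ ρ ι m t ∧ PP (pJob z D ι) σ ρ ι m t ≤ z * D := by
  have : (z * D : ℤ) = ∑ i, (ι i : ℤ) := by exact_mod_cast h.hsum.symm
  rw [this]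
  unfold PP
  constructor
  · exact Finset.sum_nonneg (fun i _ => mul_nonneg (ee_nonneg ..) (by positivity))
  · refine Finset.sum_le_sum (fun i _ => ?_)
    have h1 := ee_nonneg (pJob z D ι) σ ρ m t (.Jpart i)
    have h2 := ee_le (pJob z D ι) σ ρ m t (.Jpart i)
    have h3 : (0:ℤ) ≤ ι i := by positivity
    nlinarith

/-- bounds of the digits on machine m -/
lemma HH.bds (h : HH z D ι σ ρ) (m t : ℕ) :
    (0 ≤ 𝒩 .JA m t ∧ 𝒩 .JA m t ≤ z + 1) ∧ (0 ≤ 𝒩 .JB m t ∧ 𝒩 .JB m t ≤ z + 1) ∧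
    (0 ≤ 𝒩 .Ja m t ∧ 𝒩 .Ja m t ≤ z) ∧ (0 ≤ 𝒩 .Jb m t ∧ 𝒩 .Jb m t ≤ z) ∧
    (0 ≤ 𝒩 .Jγ m t ∧ 𝒩 .Jγ m t ≤ z) ∧ (0 ≤ 𝒩 .Jδ m t ∧ 𝒩 .Jδ m t ≤ z) ∧
    (0 ≤ 𝒩 .Jα m t ∧ 𝒩 .Jα m t ≤ z) ∧ (0 ≤ 𝒩 .Jβ m t ∧ 𝒩 .Jβ m t ≤ z) ∧
    (0 ≤ 𝒩 .Jc m t ∧ 𝒩 .Jc m t ≤ z + 1) ∧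
    (0 ≤ ℰ m t .Jl1 ∧ ℰ m t .Jl1 ≤ 1) ∧ (0 ≤ ℰ m t .Jl2 ∧ ℰ m t .Jl2 ≤ 1) := by
  have h1 : ∀ X : Fin (z+1) → Job z, 0 ≤ 𝒩 X m t ∧ 𝒩 X m t ≤ z + 1 := fun X =>
    ⟨NN_nonneg .., by have := NN_le (pJob z D ι) σ ρ X m t; push_cast at this; exact this⟩
  have h2 : ∀ X : Fin z → Job z, 0 ≤ 𝒩 X m t ∧ 𝒩 X m t ≤ z := fun X =>
    ⟨NN_nonneg .., NN_le ..⟩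
  exact ⟨h1 _, h1 _, h2 _, h2 _, h2 _, h2 _, h2 _, h2 _, h1 _, ⟨ee_nonneg .., ee_le ..⟩, ⟨ee_nonneg .., ee_le ..⟩⟩

/-- low part and seventh digit on machine m -/
lemma HH.bds7 (h : HH z D ι σ ρ) (m t : ℕ) :
    (-(z*D:ℤ) ≤ PP (pJob z D ι) σ ρ ι m t - D * 𝒩 .Jγ m t ∧
      PP (pJob z D ι) σ ρ ι m t - D * 𝒩 .Jγ m t ≤ z * D) ∧
    (0 ≤ (3*z*(𝒩 .Ja m t + 𝒩 .Jb m t) + z * 𝒩 .Jc m t + 𝒮 m t + 3*z*(𝒩 .Jγ m t + 𝒩 .Jδ m t) - 𝒥 m t) ∧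
     (3*z*(𝒩 .Ja m t + 𝒩 .Jb m t) + z * 𝒩 .Jc m t + 𝒮 m t + 3*z*(𝒩 .Jγ m t + 𝒩 .Jδ m t) - 𝒥 m t) ≤ 2*z*(7*z+1)) := by
  obtain ⟨-, -, ha, hb, hg, hd, -, -, hc, -, -⟩ := h.bds m t
  have hP := h.P_bd m t
  have hS := S_bd (D := D) (ι := ι) (σ := σ) (ρ := ρ) m t
  have hJ := J_bd (D := D) (ι := ι) (σ := σ) (ρ := ρ) m t
  have hz : (0:ℤ) ≤ z := by positivity
  have hD : (0:ℤ) ≤ D := by positivity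
  refine ⟨⟨by nlinarith, by nlinarith⟩, ?_, ?_⟩
  · have h1 : 0 ≤ (z:ℤ) * 𝒩 .Ja m t := mul_nonneg hz ha.1
    have h2 : 0 ≤ (z:ℤ) * 𝒩 .Jb m t := mul_nonneg hz hb.1
    have h3 : 0 ≤ (z:ℤ) * 𝒩 .Jc m t := mul_nonneg hz hc.1
    have h4 : 0 ≤ (z:ℤ) * 𝒩 .Jγ m t := mul_nonneg hz hg.1
    have h5 : 0 ≤ (z:ℤ) * 𝒩 .Jδ m t := mul_nonneg hz hd.1
    linarith
  · have h1 := mul_le_mul_of_nonneg_left ha.2 hz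
    have h2 := mul_le_mul_of_nonneg_left hb.2 hz
    have h3 := mul_le_mul_of_nonneg_left hc.2 hz
    have h4 := mul_le_mul_of_nonneg_left hg.2 hz
    have h5 := mul_le_mul_of_nonneg_left hd.2 hz
    linarith

lemma HH.Dz (h : HH z D ι σ ρ) : (4*z*(7*z+1) + 1 : ℤ) ≤ D ∧ (1:ℤ) ≤ z ∧ (32 * z + 1 : ℤ) ≤ D
    ∧ 2 * (z * D : ℤ) < D^2 := by
  have h1 : (4*z*(7*z+1) + 1 : ℤ) ≤ D := by exact_mod_cast h.hD
  have h2 : (1:ℤ) ≤ z := by exact_mod_cast h.hz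
  have h3 : (32 * z + 1 : ℤ) ≤ D := by nlinarith
  exact ⟨h1, h2, h3, by nlinarith⟩

lemma digits2 (D l c2 c3 c4 c5 c6 c7 c8 l' e2 e3 e4 e5 e6 e7 e8 : ℤ)
    (h : l + c2*D^2 + c3*D^3 + c4*D^4 + c5*D^5 + c6*D^6 + c7*D^7 + c8*D^8 = l' + e2*D^2 + e3*D^3 + e4*D^4 + e5*D^5 + e6*D^6 + e7*D^7 + e8*D^8)
    (hl : -D^2 < 2 * l ∧ 2 * l < D^2) (hl' : -D^2 < 2 * l' ∧ 2 * l' < D^2)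
    (h2 : 0 ≤ c2 ∧ c2 < D) (k2 : 0 ≤ e2 ∧ e2 < D) (h3 : 0 ≤ c3 ∧ c3 < D) (k3 : 0 ≤ e3 ∧ e3 < D) (h4 : 0 ≤ c4 ∧ c4 < D) (k4 : 0 ≤ e4 ∧ e4 < D) (h5 : 0 ≤ c5 ∧ c5 < D) (k5 : 0 ≤ e5 ∧ e5 < D) (h6 : 0 ≤ c6 ∧ c6 < D) (k6 : 0 ≤ e6 ∧ e6 < D) (h7 : 0 ≤ c7 ∧ c7 < D) (k7 : 0 ≤ e7 ∧ e7 < D) :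
    c2 = e2 ∧ c3 = e3 ∧ c4 = e4 ∧ c5 = e5 ∧ c6 = e6 ∧ c7 = e7 ∧ c8 = e8 := by
  obtain ⟨-, q2, q3, q4, q5, q6, q7, q8⟩ := digits D (l - l') (c2-e2) (c3-e3) (c4-e4) (c5-e5) (c6-e6) (c7-e7) (c8-e8)
    (by linear_combination h) ⟨by linarith [hl.1, hl'.2], by linarith [hl.2, hl'.1]⟩
    ⟨by linarith [h2.1, k2.2], by linarith [h2.2, k2.1]⟩ ⟨by linarith [h3.1, k3.2], by linarith [h3.2, k3.1]⟩ ⟨by linarith [h4.1, k4.2], by linarith [h4.2, k4.1]⟩ ⟨by linarith [h5.1, k5.2], by linarith [h5.2, k5.1]⟩ ⟨by linarith [h6.1, k6.2], by linarith [h6.2, k6.1]⟩ ⟨by linarith [h7.1, k7.2], by linarith [h7.2, k7.1]⟩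
  exact ⟨by linarith, by linarith, by linarith, by linarith, by linarith, by linarith, by linarith⟩

lemma HH.E1 (h : HH z D ι σ ρ) {m t : ℕ} (hm : m = 2 ∨ m = 3) (ht : t ≤ Wval z D)
    (b1 : Bd (pJob z D ι) σ ρ 1 t) (bm : Bd (pJob z D ι) σ ρ m t) :
    𝒩 .JB m t = 𝒩 .Jα 1 t + ℰ 1 t .Jl1 ∧ 𝒩 .Jc m t = 𝒩 .Jα 1 t + ℰ 1 t .Jl1 ∧
    𝒩 .Ja m t + 𝒩 .Jδ m t = 𝒩 .Ja 1 t ∧ 𝒩 .Jb m t + 𝒩 .Jγ m t = 𝒩 .Jα 1 t ∧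
    𝒩 .Ja m t + 𝒩 .Jb m t = 𝒩 .Ja 1 t ∧ 𝒥 m t = 𝒮 m t := by
  have e1 := h.load_t 1 t h.tot1 ht b1
  have em := h.load_t m t (h.totm m hm) ht bm
  rw [h.F1] at e1
  rw [h.Fm m t hm] at em
  obtain ⟨hA, hB, ha, hb, hg, hd, -, -, hc, -, -⟩ := h.bds m t
  obtain ⟨hA', -, ha', -, -, -, hα', -, -, hl, -⟩ := h.bds 1 t
  obtain ⟨hlow, h7⟩ := h.bds7 m t
  obtain ⟨k1, k2, k3, k4⟩ := h.Dz
  have hz : (0:ℤ) ≤ z := by positivity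
  have m1 := mul_le_mul_of_nonneg_left ha'.2 hz
  have m2 := mul_le_mul_of_nonneg_left hα'.2 hz
  have m3 := mul_le_mul_of_nonneg_left hl.2 hz
  have m4 := mul_nonneg hz ha'.1
  have m5 := mul_nonneg hz hα'.1
  have m6 := mul_nonneg hz hl.1
  have z0 : ((0:ℤ)) < D^2 := by nlinarith
  obtain ⟨-, q3, q4, q5, q6, q7, q8⟩ := digits2 D (PP (pJob z D ι) σ ρ ι m t - D * 𝒩 .Jγ m t) (𝒩 .JA m t) (𝒩 .JB m t)
      (𝒩 .Ja m t + 𝒩 .Jδ m t) (𝒩 .Jb m t + 𝒩 .Jγ m t) (𝒩 .Ja m t + 𝒩 .Jb m t)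
      (3*z*(𝒩 .Ja m t + 𝒩 .Jb m t) + z * 𝒩 .Jc m t + 𝒮 m t + 3*z*(𝒩 .Jγ m t + 𝒩 .Jδ m t) - 𝒥 m t)
      (𝒩 .Jc m t) 0 (𝒩 .JA 1 t) (𝒩 .Jα 1 t + ℰ 1 t .Jl1) (𝒩 .Ja 1 t) (𝒩 .Jα 1 t)
      (𝒩 .Ja 1 t) (3*z*𝒩 .Ja 1 t + 4*z*𝒩 .Jα 1 t + z*ℰ 1 t .Jl1) (𝒩 .Jα 1 t + ℰ 1 t .Jl1)
    (by rw [em] at e1; linear_combination e1)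
    ⟨by linarith, by linarith⟩ ⟨by linarith, by linarith⟩ ⟨by linarith, by linarith⟩ ⟨by linarith, by linarith⟩ ⟨by linarith, by linarith⟩ ⟨by linarith, by linarith⟩ ⟨by linarith, by linarith⟩ ⟨by linarith, by linarith⟩ ⟨by linarith, by linarith⟩ ⟨by linarith, by linarith⟩ ⟨by linarith, by linarith⟩ ⟨by linarith, by linarith⟩ ⟨by linarith, by linarith⟩ ⟨by linarith, by linarith⟩
  refine ⟨by linarith, by linarith, by linarith, by linarith, by linarith, ?_⟩
  have r1 : 𝒩 .Jγ m t = 𝒩 .Jα 1 t - 𝒩 .Jb m t := by linarith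
  have r2 : 𝒩 .Jδ m t = 𝒩 .Jb m t := by linarith
  have r3 : 𝒩 .Ja 1 t = 𝒩 .Ja m t + 𝒩 .Jb m t := by linarith
  have r4 : 𝒩 .Jc m t = 𝒩 .Jα 1 t + ℰ 1 t .Jl1 := by linarith
  rw [r1, r2, r3, r4] at q7
  linarith

lemma HH.E4 (h : HH z D ι σ ρ) {m t : ℕ} (hm : m = 2 ∨ m = 3) (ht : t ≤ Wval z D)
    (b1 : Bd (pJob z D ι) σ ρ 4 t) (bm : Bd (pJob z D ι) σ ρ m t) :
    𝒩 .JA m t = 𝒩 .Jβ 4 t + ℰ 4 t .Jl2 ∧ 𝒩 .Jc m t = 𝒩 .Jβ 4 t + ℰ 4 t .Jl2 ∧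
    𝒩 .Ja m t + 𝒩 .Jδ m t = 𝒩 .Jβ 4 t ∧ 𝒩 .Jb m t + 𝒩 .Jγ m t = 𝒩 .Jb 4 t ∧
    𝒩 .Ja m t + 𝒩 .Jb m t = 𝒩 .Jb 4 t ∧ 𝒥 m t = 𝒮 m t + 𝒩 .Jβ 4 t - z * ℰ 4 t .Jl2 := by
  have e1 := h.load_t 4 t h.tot4 ht b1
  have em := h.load_t m t (h.totm m hm) ht bm
  rw [h.F4] at e1
  rw [h.Fm m t hm] at em
  obtain ⟨hA, hB, ha, hb, hg, hd, -, -, hc, -, -⟩ := h.bds m t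
  obtain ⟨-, hA', -, ha', -, -, -, hα', -, -, hl⟩ := h.bds 4 t
  obtain ⟨hlow, h7⟩ := h.bds7 m t
  obtain ⟨k1, k2, k3, k4⟩ := h.Dz
  have hz : (0:ℤ) ≤ z := by positivity
  have m1 := mul_le_mul_of_nonneg_left ha'.2 hz
  have m2 := mul_le_mul_of_nonneg_left hα'.2 hz
  have m3 := mul_le_mul_of_nonneg_left hl.2 hz
  have m4 := mul_nonneg hz ha'.1
  have m5 := mul_nonneg (sub_nonneg.2 k2) hα'.1
  have m6 := mul_nonneg hz hl.1
  have z0 : ((0:ℤ)) < D^2 := by nlinarith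
  obtain ⟨q2, -, q4, q5, q6, q7, q8⟩ := digits2 D (PP (pJob z D ι) σ ρ ι m t - D * 𝒩 .Jγ m t) (𝒩 .JA m t) (𝒩 .JB m t)
      (𝒩 .Ja m t + 𝒩 .Jδ m t) (𝒩 .Jb m t + 𝒩 .Jγ m t) (𝒩 .Ja m t + 𝒩 .Jb m t)
      (3*z*(𝒩 .Ja m t + 𝒩 .Jb m t) + z * 𝒩 .Jc m t + 𝒮 m t + 3*z*(𝒩 .Jγ m t + 𝒩 .Jδ m t) - 𝒥 m t)
      (𝒩 .Jc m t) 0 (𝒩 .Jβ 4 t + ℰ 4 t .Jl2) (𝒩 .JB 4 t) (𝒩 .Jβ 4 t) (𝒩 .Jb 4 t)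
      (𝒩 .Jb 4 t) (3*z*𝒩 .Jb 4 t + (4*z-1)*𝒩 .Jβ 4 t + 2*z*ℰ 4 t .Jl2) (𝒩 .Jβ 4 t + ℰ 4 t .Jl2)
    (by rw [em] at e1; linear_combination e1)
    ⟨by linarith, by linarith⟩ ⟨by linarith, by linarith⟩ ⟨by linarith, by linarith⟩ ⟨by linarith, by linarith⟩ ⟨by linarith, by linarith⟩ ⟨by linarith, by linarith⟩ ⟨by linarith, by linarith⟩ ⟨by linarith, by linarith⟩ ⟨by linarith, by linarith⟩ ⟨by linarith, by linarith⟩ ⟨by linarith, by linarith⟩ ⟨by linarith, by linarith⟩ ⟨by linarith, by linarith⟩ ⟨by linarith, by linarith⟩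
  refine ⟨by linarith, by linarith, by linarith, by linarith, by linarith, ?_⟩
  have r1 : 𝒩 .Jγ m t = 𝒩 .Ja m t := by linarith
  have r2 : 𝒩 .Jδ m t = 𝒩 .Jβ 4 t - 𝒩 .Ja m t := by linarith
  have r3 : 𝒩 .Jb 4 t = 𝒩 .Ja m t + 𝒩 .Jb m t := by linarith
  have r4 : 𝒩 .Jc m t = 𝒩 .Jβ 4 t + ℰ 4 t .Jl2 := by linarith
  rw [r1, r2, r3, r4] at q7
  linarith

lemma HH.E23 (h : HH z D ι σ ρ) {t : ℕ} (ht : t ≤ Wval z D)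
    (b2 : Bd (pJob z D ι) σ ρ 2 t) (b3 : Bd (pJob z D ι) σ ρ 3 t) :
    𝒩 .Ja 2 t + 𝒩 .Jb 2 t = 𝒩 .Ja 3 t + 𝒩 .Jb 3 t := by
  have e2 := h.load_t 2 t (h.totm 2 (by simp)) ht b2
  have e3 := h.load_t 3 t (h.totm 3 (by simp)) ht b3
  rw [h.Fm _ t (by simp)] at e2
  rw [h.Fm _ t (by simp)] at e3
  obtain ⟨hA, hB, ha, hb, hg, hd, -, -, hc, -, -⟩ := h.bds 2 t
  obtain ⟨hA', hB', ha', hb', hg', hd', -, -, hc', -, -⟩ := h.bds 3 t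
  obtain ⟨hlow, h7⟩ := h.bds7 2 t
  obtain ⟨hlow', h7'⟩ := h.bds7 3 t
  obtain ⟨k1, k2, k3, k4⟩ := h.Dz
  exact (digits2 D (PP (pJob z D ι) σ ρ ι 2 t - D * 𝒩 .Jγ 2 t) (𝒩 .JA 2 t) (𝒩 .JB 2 t)
      (𝒩 .Ja 2 t + 𝒩 .Jδ 2 t) (𝒩 .Jb 2 t + 𝒩 .Jγ 2 t) (𝒩 .Ja 2 t + 𝒩 .Jb 2 t)
      (3*z*(𝒩 .Ja 2 t + 𝒩 .Jb 2 t) + z * 𝒩 .Jc 2 t + 𝒮 2 t + 3*z*(𝒩 .Jγ 2 t + 𝒩 .Jδ 2 t) - 𝒥 2 t)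
      (𝒩 .Jc 2 t) (PP (pJob z D ι) σ ρ ι 3 t - D * 𝒩 .Jγ 3 t) (𝒩 .JA 3 t) (𝒩 .JB 3 t)
      (𝒩 .Ja 3 t + 𝒩 .Jδ 3 t) (𝒩 .Jb 3 t + 𝒩 .Jγ 3 t) (𝒩 .Ja 3 t + 𝒩 .Jb 3 t)
      (3*z*(𝒩 .Ja 3 t + 𝒩 .Jb 3 t) + z * 𝒩 .Jc 3 t + 𝒮 3 t + 3*z*(𝒩 .Jγ 3 t + 𝒩 .Jδ 3 t) - 𝒥 3 t)
      (𝒩 .Jc 3 t)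
    (by rw [e2] at e3; linear_combination e3)
    ⟨by linarith, by linarith⟩ ⟨by linarith, by linarith⟩ ⟨by linarith, by linarith⟩ ⟨by linarith, by linarith⟩ ⟨by linarith, by linarith⟩ ⟨by linarith, by linarith⟩ ⟨by linarith, by linarith⟩ ⟨by linarith, by linarith⟩ ⟨by linarith, by linarith⟩ ⟨by linarith, by linarith⟩ ⟨by linarith, by linarith⟩ ⟨by linarith, by linarith⟩ ⟨by linarith, by linarith⟩ ⟨by linarith, by linarith⟩).2.2.2.2.1

local notation "𝐀" => NN (pJob z D ι) σ ρ Job.JA 1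
local notation "𝐁" => NN (pJob z D ι) σ ρ Job.JB 4
local notation "𝐂" => NN (pJob z D ι) σ ρ Job.Jc 2
local notation "𝐚" => NN (pJob z D ι) σ ρ Job.Ja 1
local notation "𝐛" => NN (pJob z D ι) σ ρ Job.Jb 4
local notation "𝛂" => NN (pJob z D ι) σ ρ Job.Jα 1
local notation "𝛃" => NN (pJob z D ι) σ ρ Job.Jβ 4

lemma HH.pos (h : HH z D ι σ ρ) (j : Job z)
    (hj : BothM23 j ∨ (∃ i, j = .Ja i) ∨ ∃ i, j = .Jb i) : 0 < pJob z D ι j := by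
  have hD : 0 < D := by have := h.hD; omega
  rcases hj with hj | ⟨i, rfl⟩ | ⟨i, rfl⟩
  · cases j <;> simp [BothM23] at hj <;> simp only [pJob] <;> positivity
  · simp only [pJob]; positivity
  · simp only [pJob]; positivity

lemma HH.pA (h : HH z D ι σ ρ) (i) : 0 < pJob z D ι (.JA i) := h.pos _ (Or.inl trivial)
lemma HH.pB (h : HH z D ι σ ρ) (i) : 0 < pJob z D ι (.JB i) := h.pos _ (Or.inl trivial)
lemma HH.pa (h : HH z D ι σ ρ) (i) : 0 < pJob z D ι (.Ja i) := h.pos _ (Or.inr (Or.inl ⟨i, rfl⟩))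
lemma HH.pb (h : HH z D ι σ ρ) (i) : 0 < pJob z D ι (.Jb i) := h.pos _ (Or.inr (Or.inr ⟨i, rfl⟩))

lemma HH.mach (h : HH z D ι σ ρ) {j : Job z} (hj : OneM23 j) : ∃ m, (m = 2 ∨ m = 3) ∧ m ∈ ρ j := by
  have := h.nf.2.2.2 j hj
  by_cases h2 : 2 ∈ ρ j
  · exact ⟨2, by simp, h2⟩
  · exact ⟨3, by simp, by tauto⟩

lemma HH.tW (h : HH z D ι σ ρ) (j : Job z) : σ j ≤ Wval z D := by have := h.hend j; omega

lemma HH.sA (h : HH z D ι σ ρ) {m} (hm : m = 2 ∨ m = 3) (t) : 𝒩 .JA m t = 𝐀 t :=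
  same .JA _ _ (fun i => h.both hm trivial) h.A1 t
lemma HH.sB (h : HH z D ι σ ρ) {m} (hm : m = 2 ∨ m = 3) (t) : 𝒩 .JB m t = 𝐁 t :=
  same .JB _ _ (fun i => h.both hm trivial) h.B4 t
lemma HH.sC (h : HH z D ι σ ρ) {m} (hm : m = 2 ∨ m = 3) (t) : 𝒩 .Jc m t = 𝐂 t :=
  same .Jc _ _ (fun i => h.both hm trivial) (fun i => h.both (Or.inl rfl) trivial) t
lemma HH.sS (h : HH z D ι σ ρ) {m} (hm : m = 2 ∨ m = 3) (t) : 𝒮 m t = 𝒮 2 t := by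
  unfold SS
  refine Finset.sum_congr rfl (fun i _ => ?_)
  have h1 : m ∈ ρ (.Jc i) := h.both hm trivial
  have h2 : 2 ∈ ρ (.Jc i) := h.both (Or.inl rfl) trivial
  simp [ee, h1, h2]

lemma HH.X1 (h : HH z D ι σ ρ) {m : ℕ} {j : Job z} (hm : m = 2 ∨ m = 3) (h1 : 1 ∈ ρ j) (h2 : m ∈ ρ j) :
    𝐁 (σ j) = 𝛂 (σ j) + ℰ 1 (σ j) .Jl1 ∧ 𝐂 (σ j) = 𝛂 (σ j) + ℰ 1 (σ j) .Jl1 ∧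
    𝒩 .Ja m (σ j) + 𝒩 .Jδ m (σ j) = 𝐚 (σ j) ∧ 𝒩 .Jb m (σ j) + 𝒩 .Jγ m (σ j) = 𝛂 (σ j) ∧
    𝒩 .Ja m (σ j) + 𝒩 .Jb m (σ j) = 𝐚 (σ j) ∧ 𝒥 m (σ j) = 𝒮 2 (σ j) := by
  have := h.E1 hm (h.tW j) (h.bd_start h1) (h.bd_start h2)
  rwa [h.sB hm, h.sC hm, h.sS hm] at this

lemma HH.X4 (h : HH z D ι σ ρ) {m : ℕ} {j : Job z} (hm : m = 2 ∨ m = 3) (h1 : 4 ∈ ρ j) (h2 : m ∈ ρ j) :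
    𝐀 (σ j) = 𝛃 (σ j) + ℰ 4 (σ j) .Jl2 ∧ 𝐂 (σ j) = 𝛃 (σ j) + ℰ 4 (σ j) .Jl2 ∧
    𝒩 .Ja m (σ j) + 𝒩 .Jδ m (σ j) = 𝛃 (σ j) ∧ 𝒩 .Jb m (σ j) + 𝒩 .Jγ m (σ j) = 𝐛 (σ j) ∧
    𝒩 .Ja m (σ j) + 𝒩 .Jb m (σ j) = 𝐛 (σ j) ∧
    𝒥 m (σ j) = 𝒮 2 (σ j) + 𝛃 (σ j) - z * ℰ 4 (σ j) .Jl2 := by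
  have := h.E4 hm (h.tW j) (h.bd_start h1) (h.bd_start h2)
  rwa [h.sA hm, h.sC hm, h.sS hm] at this

lemma HH.spa (h : HH z D ι σ ρ) (t) : 𝒩 .Ja 2 t + 𝒩 .Ja 3 t = 𝐚 t := h.split .Ja (fun _ => trivial) _ h.a1 t
lemma HH.spb (h : HH z D ι σ ρ) (t) : 𝒩 .Jb 2 t + 𝒩 .Jb 3 t = 𝐛 t := h.split .Jb (fun _ => trivial) _ h.b4 t

lemma bef {k} {X : Fin k → Job z} {m m' : ℕ} {i : Fin k} {t : ℕ} (hb : Bd (pJob z D ι) σ ρ m' t) (hm : m' ∈ ρ (X i))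
    (hr : 𝒩 X m (σ (X i)) < 𝒩 X m t) : σ (X i) + pJob z D ι (X i) ≤ t := by
  rcases hb _ hm with h1 | h1
  · exact h1
  · have := NN_mono (pJob z D ι) σ ρ X m h1; omega

lemma aft {k} {X : Fin k → Job z} {m m' : ℕ} {i : Fin k} {t : ℕ} (hb : Bd (pJob z D ι) σ ρ m' t) (hm' : m' ∈ ρ (X i))
    (hm : m ∈ ρ (X i)) (hp : 0 < pJob z D ι (X i))
    (hr : 𝒩 X m t ≤ 𝒩 X m (σ (X i))) : t ≤ σ (X i) := by
  rcases hb _ hm' with h1 | h1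
  · have := NN_lt (pJob z D ι) σ ρ X m i hm hp h1; omega
  · exact h1

lemma HH.ra (h : HH z D ι σ ρ) (r : ℤ) (h0 : 0 ≤ r) (hr : r < z) : ∃ i, 𝐚 (σ (.Ja i)) = r :=
  rank_ex _ _ _ _ _ h.a1 h.pa (fun i i' hne => h.comp (by simpa using hne) (h.a1 i) (h.a1 i')) r h0 hr
lemma HH.rb (h : HH z D ι σ ρ) (r : ℤ) (h0 : 0 ≤ r) (hr : r < z) : ∃ i, 𝐛 (σ (.Jb i)) = r :=
  rank_ex _ _ _ _ _ h.b4 h.pb (fun i i' hne => h.comp (by simpa using hne) (h.b4 i) (h.b4 i')) r h0 hr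
lemma HH.rA (h : HH z D ι σ ρ) (r : ℤ) (h0 : 0 ≤ r) (hr : r < z + 1) : ∃ i, 𝐀 (σ (.JA i)) = r :=
  rank_ex _ _ _ _ _ h.A1 h.pA (fun i i' hne => h.comp (by simpa using hne) (h.A1 i) (h.A1 i')) r h0 (by push_cast; exact hr)
lemma HH.rB (h : HH z D ι σ ρ) (r : ℤ) (h0 : 0 ≤ r) (hr : r < z + 1) : ∃ i, 𝐁 (σ (.JB i)) = r :=
  rank_ex _ _ _ _ _ h.B4 h.pB (fun i i' hne => h.comp (by simpa using hne) (h.B4 i) (h.B4 i')) r h0 (by push_cast; exact hr)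

lemma HH.sync (h : HH z D ι σ ρ) {t : ℕ} (ht : t ≤ Wval z D)
    (b2 : Bd (pJob z D ι) σ ρ 2 t) (b3 : Bd (pJob z D ι) σ ρ 3 t) : 𝐚 t = 𝐛 t := by
  have e := h.E23 ht b2 b3
  have sa := h.spa t
  have sb := h.spb t
  have hz : (1:ℤ) ≤ z := by have := h.hz; omega
  have hbd : ∀ m, m = 2 ∨ m = 3 → Bd (pJob z D ι) σ ρ m t := by rintro m (rfl | rfl) <;> assumption
  have ba := (h.bds 1 t).2.2.1
  have bb := (h.bds 4 t).2.2.2.1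
  have c1 : 𝐚 t ≤ 𝐛 t := by
    by_cases h0 : 𝐚 t = 0
    · omega
    obtain ⟨i, hi⟩ := h.ra (𝐚 t - 1) (by omega) (by omega)
    obtain ⟨m, hm, hmi⟩ := h.mach (j := .Ja i) trivial
    have hbef := bef (m := 1) (hbd m hm) hmi (by omega)
    have q := (h.X1 hm (h.a1 i) hmi).2.2.2.2.1
    have q1 := NN_lt (pJob z D ι) σ ρ .Ja m i hmi (h.pa i) hbef
    have q2 := NN_mono (pJob z D ι) σ ρ .Jb m (show σ (.Ja i) ≤ t by omega)
    rcases hm with rfl | rfl <;> omega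
  have c2 : 𝐛 t ≤ 𝐚 t := by
    by_cases h0 : 𝐛 t = 0
    · omega
    obtain ⟨i, hi⟩ := h.rb (𝐛 t - 1) (by omega) (by omega)
    obtain ⟨m, hm, hmi⟩ := h.mach (j := .Jb i) trivial
    have hbef := bef (m := 4) (hbd m hm) hmi (by omega)
    have q := (h.X4 hm (h.b4 i) hmi).2.2.2.2.1
    have q1 := NN_lt (pJob z D ι) σ ρ .Jb m i hmi (h.pb i) hbef
    have q2 := NN_mono (pJob z D ι) σ ρ .Ja m (show σ (.Jb i) ≤ t by omega)
    rcases hm with rfl | rfl <;> omega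
  omega

lemma HH.syncj (h : HH z D ι σ ρ) {j : Job z} (hj : BothM23 j) : 𝐚 (σ j) = 𝐛 (σ j) :=
  h.sync (h.tW j) (h.bd_start (h.both (by simp) hj)) (h.bd_start (h.both (by simp) hj))

lemma HH.bef_a (h : HH z D ι σ ρ) {j : Job z} (hj : BothM23 j) (i) :
    σ j + pJob z D ι j ≤ σ (.Ja i) ↔ 𝐚 (σ j) ≤ 𝐚 (σ (.Ja i)) := by
  constructor
  · intro hh; exact NN_mono _ _ _ _ _ (by omega)
  · intro hh
    obtain ⟨m, hm, hmi⟩ := h.mach (j := .Ja i) trivial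
    rcases h.comp (j := j) (j' := .Ja i) (by rintro rfl; exact hj) (h.both hm hj) hmi with h1 | h1
    · exact h1
    · have := NN_lt (pJob z D ι) σ ρ .Ja 1 i (h.a1 i) (h.pa i) h1; omega
lemma HH.bef_b (h : HH z D ι σ ρ) {j : Job z} (hj : BothM23 j) (i) :
    σ j + pJob z D ι j ≤ σ (.Jb i) ↔ 𝐛 (σ j) ≤ 𝐛 (σ (.Jb i)) := by
  constructor
  · intro hh; exact NN_mono _ _ _ _ _ (by omega)
  · intro hh
    obtain ⟨m, hm, hmi⟩ := h.mach (j := .Jb i) trivial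
    rcases h.comp (j := j) (j' := .Jb i) (by rintro rfl; exact hj) (h.both hm hj) hmi with h1 | h1
    · exact h1
    · have := NN_lt (pJob z D ι) σ ρ .Jb 4 i (h.b4 i) (h.pb i) h1; omega

lemma HH.key2 (h : HH z D ι σ ρ) (i) : 𝐀 (σ (.Ja i)) = 𝐂 (σ (.Ja i)) ∧ 𝐁 (σ (.Ja i)) = 𝐂 (σ (.Ja i)) := by
  obtain ⟨m, hm, hmi⟩ := h.mach (j := .Ja i) trivial
  have q := h.X1 hm (h.a1 i) hmi
  refine ⟨?_, by omega⟩
  have hlt := NN_lt_card (pJob z D ι) σ ρ .Ja 1 i (h.pa i) le_rfl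
  obtain ⟨r, hr⟩ := h.rb (𝐚 (σ (.Ja i))) (NN_nonneg ..) (by omega)
  obtain ⟨m', hm', hmr⟩ := h.mach (j := .Jb r) trivial
  have q' := h.X4 hm' (h.b4 r) hmr
  have key : ∀ (k : ℕ) (X : Fin k → Job z) (m : ℕ), (∀ l, BothM23 (X l)) → 𝒩 X m (σ (.Ja i)) = 𝒩 X m (σ (.Jb r)) := by
    intro k X m hX
    unfold NN
    refine Finset.sum_congr rfl (fun l _ => ?_)
    have hiff : σ (X l) + pJob z D ι (X l) ≤ σ (.Ja i) ↔ σ (X l) + pJob z D ι (X l) ≤ σ (.Jb r) := by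
      rw [h.bef_a (hX l), h.bef_b (hX l), hr, h.syncj (hX l)]
    unfold ee
    simp only [hiff]
  have k1 := key _ .JA 1 (fun _ => trivial)
  have k2 := key _ .Jc 2 (fun _ => trivial)
  omega

lemma J_const {m s t : ℕ} (hst : s ≤ t) (he : 𝒩 .Jγ m s + 𝒩 .Jδ m s = 𝒩 .Jγ m t + 𝒩 .Jδ m t) :
    𝒥 m s = 𝒥 m t := by
  have h1 := NN_mono (pJob z D ι) σ ρ .Jγ m hst
  have h2 := NN_mono (pJob z D ι) σ ρ .Jδ m hst
  have e1 := NN_eq_pt (pJob z D ι) σ ρ .Jγ m hst (by omega)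
  have e2 := NN_eq_pt (pJob z D ι) σ ρ .Jδ m hst (by omega)
  unfold JJ
  simp only [e1, e2]

lemma S_const {s t : ℕ} (hst : s ≤ t) (he : 𝐂 s = 𝐂 t) : 𝒮 2 s = 𝒮 2 t := by
  have e1 := NN_eq_pt (pJob z D ι) σ ρ .Jc 2 hst he
  unfold SS
  simp only [e1]

/-- a family where exactly one job is added -/
lemma one_add (X : Fin z → Job z) {m s t : ℕ} (n : ℤ) (hst : s ≤ t) (h1 : 𝒩 X m t = 𝒩 X m s + 1)
    (h2 : ∑ i, ℰ m t (X i) * ((i.val:ℤ)+1) = ∑ i, ℰ m s (X i) * ((i.val:ℤ)+1) + n) :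
    ∃ i : Fin z, ℰ m t (X i) = 1 ∧ (i.val:ℤ) + 1 = n := by
  obtain ⟨i, hi, hn⟩ := single_idx (fun i => ℰ m t (X i) - ℰ m s (X i)) n
    (fun i => sub_nonneg.2 (ee_mono _ _ _ _ _ hst))
    (by unfold NN at h1; rw [Finset.sum_sub_distrib]; linarith)
    (by simp only [sub_mul]; rw [Finset.sum_sub_distrib]; linarith)
  refine ⟨i, ?_, hn⟩
  have := ee_le (pJob z D ι) σ ρ m t (X i)
  have := ee_nonneg (pJob z D ι) σ ρ m s (X i)
  have hi2 : 0 < ℰ m t (X i) - ℰ m s (X i) := hi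
  omega

lemma sum_const (X : Fin z → Job z) {m s t : ℕ} (hst : s ≤ t) (h1 : 𝒩 X m t = 𝒩 X m s) :
    ∑ i, ℰ m t (X i) * ((i.val:ℤ)+1) = ∑ i, ℰ m s (X i) * ((i.val:ℤ)+1) := by
  have e1 := NN_eq_pt (pJob z D ι) σ ρ X m hst h1.symm
  simp only [e1]

lemma HH.not_two (h : HH z D ι σ ρ) (X : Fin z → Job z) (hX : ∀ i, OneM23 (X i)) {s t : ℕ} (n : ℤ) (hst : s ≤ t)
    (h1 : 𝒩 X 2 t = 𝒩 X 2 s + 1) (h1' : 𝒩 X 3 t = 𝒩 X 3 s + 1)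
    (h2 : ∑ i, ℰ 2 t (X i) * ((i.val:ℤ)+1) = ∑ i, ℰ 2 s (X i) * ((i.val:ℤ)+1) + n)
    (h2' : ∑ i, ℰ 3 t (X i) * ((i.val:ℤ)+1) = ∑ i, ℰ 3 s (X i) * ((i.val:ℤ)+1) + n) : False := by
  obtain ⟨i, a1, a2⟩ := one_add X n hst h1 h2
  obtain ⟨i', b1, b2⟩ := one_add X n hst h1' h2'
  have : i = i' := Fin.ext (by omega)
  subst this
  have := ee_split h t (hX i)
  rw [a1, b1] at this
  split_ifs at this <;> omega

lemma HH.pair_idx (h : HH z D ι σ ρ) {s t : ℕ} (n : ℤ) (hst : s ≤ t)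
    (e2 : 𝒩 .Jγ 2 t + 𝒩 .Jδ 2 t = 𝒩 .Jγ 2 s + 𝒩 .Jδ 2 s + 1)
    (e3 : 𝒩 .Jγ 3 t + 𝒩 .Jδ 3 t = 𝒩 .Jγ 3 s + 𝒩 .Jδ 3 s + 1)
    (j2 : 𝒥 2 t = 𝒥 2 s + n) (j3 : 𝒥 3 t = 𝒥 3 s + n) :
    𝒩 .Jγ 2 t + 𝒩 .Jγ 3 t = 𝒩 .Jγ 2 s + 𝒩 .Jγ 3 s + 1 ∧
    𝒩 .Jδ 2 t + 𝒩 .Jδ 3 t = 𝒩 .Jδ 2 s + 𝒩 .Jδ 3 s + 1 := by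
  have g2 := NN_mono (pJob z D ι) σ ρ .Jγ 2 hst
  have g3 := NN_mono (pJob z D ι) σ ρ .Jγ 3 hst
  have d2 := NN_mono (pJob z D ι) σ ρ .Jδ 2 hst
  have d3 := NN_mono (pJob z D ι) σ ρ .Jδ 3 hst
  unfold JJ at j2 j3
  by_cases c2 : 𝒩 .Jγ 2 t = 𝒩 .Jγ 2 s
  · by_cases c3 : 𝒩 .Jγ 3 t = 𝒩 .Jγ 3 s
    · exfalso
      have f2 := sum_const .Jγ hst c2
      have f3 := sum_const .Jγ hst c3
      exact h.not_two .Jδ (fun _ => trivial) n hst (by omega) (by omega) (by linarith) (by linarith)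
    · constructor <;> omega
  · by_cases c3 : 𝒩 .Jγ 3 t = 𝒩 .Jγ 3 s
    · constructor <;> omega
    · exfalso
      have f2 := sum_const .Jδ hst (show 𝒩 .Jδ 2 t = 𝒩 .Jδ 2 s by omega)
      have f3 := sum_const .Jδ hst (show 𝒩 .Jδ 3 t = 𝒩 .Jδ 3 s by omega)
      exact h.not_two .Jγ (fun _ => trivial) n hst (by omega) (by omega) (by linarith) (by linarith)

lemma HH.XA (h : HH z D ι σ ρ) (i) {m} (hm : m = 2 ∨ m = 3) :
    𝐁 (σ (.JA i)) = 𝛂 (σ (.JA i)) + ℰ 1 (σ (.JA i)) .Jl1 ∧ 𝐂 (σ (.JA i)) = 𝛂 (σ (.JA i)) + ℰ 1 (σ (.JA i)) .Jl1 ∧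
    𝒩 .Ja m (σ (.JA i)) + 𝒩 .Jδ m (σ (.JA i)) = 𝐚 (σ (.JA i)) ∧ 𝒩 .Jb m (σ (.JA i)) + 𝒩 .Jγ m (σ (.JA i)) = 𝛂 (σ (.JA i)) ∧
    𝒩 .Ja m (σ (.JA i)) + 𝒩 .Jb m (σ (.JA i)) = 𝐚 (σ (.JA i)) ∧ 𝒥 m (σ (.JA i)) = 𝒮 2 (σ (.JA i)) :=
  h.X1 (j := .JA i) hm (h.A1 i) (h.both hm trivial)
lemma HH.XB (h : HH z D ι σ ρ) (i) {m} (hm : m = 2 ∨ m = 3) :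
    𝐀 (σ (.JB i)) = 𝛃 (σ (.JB i)) + ℰ 4 (σ (.JB i)) .Jl2 ∧ 𝐂 (σ (.JB i)) = 𝛃 (σ (.JB i)) + ℰ 4 (σ (.JB i)) .Jl2 ∧
    𝒩 .Ja m (σ (.JB i)) + 𝒩 .Jδ m (σ (.JB i)) = 𝛃 (σ (.JB i)) ∧ 𝒩 .Jb m (σ (.JB i)) + 𝒩 .Jγ m (σ (.JB i)) = 𝐛 (σ (.JB i)) ∧
    𝒩 .Ja m (σ (.JB i)) + 𝒩 .Jb m (σ (.JB i)) = 𝐛 (σ (.JB i)) ∧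
    𝒥 m (σ (.JB i)) = 𝒮 2 (σ (.JB i)) + 𝛃 (σ (.JB i)) - z * ℰ 4 (σ (.JB i)) .Jl2 :=
  h.X4 (j := .JB i) hm (h.B4 i) (h.both hm trivial)
lemma HH.sple (h : HH z D ι σ ρ) (X : Fin z → Job z) (hX : ∀ i, OneM23 (X i)) {t : ℕ} (ht : t ≤ Wval z D) :
    𝒩 X 2 t + 𝒩 X 3 t ≤ z := by
  rw [← h.NW2 X hX]
  exact add_le_add (NN_mono _ _ _ _ _ ht) (NN_mono _ _ _ _ _ ht)

lemma HH.gapAA (h : HH z D ι σ ρ) (i i') (hst : σ (.JA i) ≤ σ (.JA i')) (e : 𝐁 (σ (.JA i)) = 𝐁 (σ (.JA i'))) :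
    𝐚 (σ (.JA i)) = 𝐚 (σ (.JA i')) := by
  obtain ⟨p1, -, p2, p3, p4, -⟩ := h.XA i (Or.inl rfl)
  obtain ⟨-, -, p2', p3', p4', -⟩ := h.XA i (Or.inr rfl)
  obtain ⟨q1, -, q2, q3, q4, -⟩ := h.XA i' (Or.inl rfl)
  obtain ⟨-, -, q2', q3', q4', -⟩ := h.XA i' (Or.inr rfl)
  have r1 := h.spa (σ (.JA i))
  have r2 := h.spa (σ (.JA i'))
  have m1 := ee_mono (pJob z D ι) σ ρ 1 .Jl1 hst
  have m2 := NN_mono (pJob z D ι) σ ρ .Jα 1 hst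
  have m3 := NN_mono (pJob z D ι) σ ρ .Jγ 2 hst
  have m4 := NN_mono (pJob z D ι) σ ρ .Jγ 3 hst
  have m5 := NN_mono (pJob z D ι) σ ρ .Ja 1 hst
  omega

lemma HH.gapBB (h : HH z D ι σ ρ) (i i') (hst : σ (.JB i) ≤ σ (.JB i')) (e : 𝐀 (σ (.JB i)) = 𝐀 (σ (.JB i'))) :
    𝐚 (σ (.JB i)) = 𝐚 (σ (.JB i')) := by
  obtain ⟨p1, -, p2, p3, p4, -⟩ := h.XB i (Or.inl rfl)
  obtain ⟨-, -, p2', p3', p4', -⟩ := h.XB i (Or.inr rfl)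
  obtain ⟨q1, -, q2, q3, q4, -⟩ := h.XB i' (Or.inl rfl)
  obtain ⟨-, -, q2', q3', q4', -⟩ := h.XB i' (Or.inr rfl)
  have r1 := h.spa (σ (.JB i))
  have r2 := h.spa (σ (.JB i'))
  have m1 := ee_mono (pJob z D ι) σ ρ 4 .Jl2 hst
  have m2 := NN_mono (pJob z D ι) σ ρ .Jβ 4 hst
  have m3 := NN_mono (pJob z D ι) σ ρ .Jδ 2 hst
  have m4 := NN_mono (pJob z D ι) σ ρ .Jδ 3 hst
  have m5 := NN_mono (pJob z D ι) σ ρ .Ja 1 hst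
  omega

lemma HH.extA (h : HH z D ι σ ρ) (i) : (𝐁 (σ (.JA i)) = 0 → 𝐚 (σ (.JA i)) = 0) ∧
    (𝐁 (σ (.JA i)) = z + 1 → 𝐚 (σ (.JA i)) = z) := by
  obtain ⟨p1, -, p2, p3, p4, -⟩ := h.XA i (Or.inl rfl)
  obtain ⟨-, -, p2', p3', p4', -⟩ := h.XA i (Or.inr rfl)
  have r1 := h.spa (σ (.JA i))
  have r2 := h.spb (σ (.JA i))
  have r3 := h.sple .Jγ (fun _ => trivial) (h.tW (.JA i))
  have b1 := h.bds 1 (σ (.JA i))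
  have b2 := h.bds 2 (σ (.JA i))
  have b3 := h.bds 3 (σ (.JA i))
  have b4 := h.bds 4 (σ (.JA i))
  omega

lemma HH.extB (h : HH z D ι σ ρ) (i) : (𝐀 (σ (.JB i)) = 0 → 𝐚 (σ (.JB i)) = 0) ∧
    (𝐀 (σ (.JB i)) = z + 1 → 𝐚 (σ (.JB i)) = z) := by
  obtain ⟨p1, -, p2, p3, p4, -⟩ := h.XB i (Or.inl rfl)
  obtain ⟨-, -, p2', p3', p4', -⟩ := h.XB i (Or.inr rfl)
  have r1 := h.spa (σ (.JB i))
  have r2 := h.spb (σ (.JB i))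
  have r3 := h.sple .Jδ (fun _ => trivial) (h.tW (.JB i))
  have b1 := h.bds 1 (σ (.JB i))
  have b2 := h.bds 2 (σ (.JB i))
  have b3 := h.bds 3 (σ (.JB i))
  have b4 := h.bds 4 (σ (.JB i))
  omega

set_option maxHeartbeats 1000000 in
lemma HH.gapAB (h : HH z D ι σ ρ) (i i') (n : ℤ) (hst : σ (.JA i) ≤ σ (.JB i')) (n1 : 1 ≤ n) (nz : n ≤ z)
    (e : 𝐁 (σ (.JA i)) = n) (e' : 𝐀 (σ (.JB i')) = n) (hlt : 𝐚 (σ (.JA i)) < 𝐚 (σ (.JB i'))) :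
    ℰ 4 (σ (.JB i')) .Jl2 = 0 ∧ 𝐚 (σ (.JB i')) = 𝐚 (σ (.JA i)) + 1 := by
  obtain ⟨p0, p1, p2, p3, p4, p5⟩ := h.XA i (Or.inl rfl)
  obtain ⟨-, -, p2', p3', p4', p5'⟩ := h.XA i (Or.inr rfl)
  obtain ⟨q0, q1, q2, q3, q4, q5⟩ := h.XB i' (Or.inl rfl)
  obtain ⟨-, -, q2', q3', q4', q5'⟩ := h.XB i' (Or.inr rfl)
  have y1 := h.syncj (j := .JA i) trivial
  have y2 := h.syncj (j := .JB i') trivial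
  have r1 := h.spa (σ (.JA i))
  have r2 := h.spb (σ (.JA i))
  have r3 := h.spa (σ (.JB i'))
  have r4 := h.spb (σ (.JB i'))
  have mγ2 := NN_mono (pJob z D ι) σ ρ .Jγ 2 hst
  have mγ3 := NN_mono (pJob z D ι) σ ρ .Jγ 3 hst
  have mδ2 := NN_mono (pJob z D ι) σ ρ .Jδ 2 hst
  have mδ3 := NN_mono (pJob z D ι) σ ρ .Jδ 3 hst
  have ma2 := NN_mono (pJob z D ι) σ ρ .Ja 2 hst
  have ma3 := NN_mono (pJob z D ι) σ ρ .Ja 3 hst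
  have l1a := ee_nonneg (pJob z D ι) σ ρ 1 (σ (.JA i)) .Jl1
  have l1b := ee_le (pJob z D ι) σ ρ 1 (σ (.JA i)) .Jl1
  have l2a := ee_nonneg (pJob z D ι) σ ρ 4 (σ (.JB i')) .Jl2
  have l2b := ee_le (pJob z D ι) σ ρ 4 (σ (.JB i')) .Jl2
  have hS := S_const (D := D) (ι := ι) (σ := σ) (ρ := ρ) hst (by omega)
  have hne : ℰ 1 (σ (.JA i)) .Jl1 ≠ ℰ 4 (σ (.JB i')) .Jl2 := by
    intro heq
    have hJ := J_const (D := D) (ι := ι) (σ := σ) (ρ := ρ) (m := 2) hst (by omega)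
    rcases (show ℰ 4 (σ (.JB i')) .Jl2 = 0 ∨ ℰ 4 (σ (.JB i')) .Jl2 = 1 by omega) with h0 | h0
    · rw [h0] at q5; omega
    · rw [h0] at q5; omega
  have L1 : ℰ 1 (σ (.JA i)) .Jl1 = 1 := by omega
  have L2 : ℰ 4 (σ (.JB i')) .Jl2 = 0 := by omega
  refine ⟨L2, ?_⟩
  rw [L2] at q0 q1 q5 q5'
  rw [L1] at p0 p1
  obtain ⟨g1, g2⟩ := h.pair_idx n hst (by omega) (by omega) (by omega) (by omega)
  have az := NN_le (pJob z D ι) σ ρ .Ja 1 (σ (.JB i'))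
  have a0 := NN_nonneg (pJob z D ι) σ ρ .Ja 1 (σ (.JA i))
  obtain ⟨l, hl⟩ := h.ra (𝐚 (σ (.JB i')) - 1) (by omega) (by omega)
  obtain ⟨m, hm, hml⟩ := h.mach (j := .Ja l) trivial
  have b1 := (h.bef_a (j := .JA i) trivial l).2 (by omega)
  have b2 := bef (m := 1) (h.bd_start (h.both hm (j := .JB i') trivial)) hml (by omega)
  obtain ⟨-, s1, -, s3, s4, -⟩ := h.X1 hm (h.a1 l) hml
  have t1 : σ (.JA i) ≤ σ (.Ja l) := by omega
  have t2 : σ (.Ja l) ≤ σ (.JB i') := by omega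
  have c1 := NN_mono (pJob z D ι) σ ρ .Jc 2 t1
  have c2 := NN_mono (pJob z D ι) σ ρ .Jc 2 t2
  have c3 := NN_mono (pJob z D ι) σ ρ .Jα 1 t1
  have c4 := ee_mono (pJob z D ι) σ ρ 1 .Jl1 t1
  have c5 := NN_mono (pJob z D ι) σ ρ .Jb m t1
  have c6 := NN_mono (pJob z D ι) σ ρ .Jγ m t1
  have c7 := NN_lt (pJob z D ι) σ ρ .Ja m l hml (h.pa l) b2
  rcases hm with rfl | rfl <;> omega

set_option maxHeartbeats 1000000 in
lemma HH.gapBA (h : HH z D ι σ ρ) (i i') (n : ℤ) (hst : σ (.JB i) ≤ σ (.JA i')) (n1 : 1 ≤ n) (nz : n ≤ z)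
    (e : 𝐀 (σ (.JB i)) = n) (e' : 𝐁 (σ (.JA i')) = n) (hlt : 𝐚 (σ (.JB i)) < 𝐚 (σ (.JA i'))) :
    ℰ 4 (σ (.JB i)) .Jl2 = 1 ∧ 𝐚 (σ (.JA i')) = 𝐚 (σ (.JB i)) + 1 := by
  obtain ⟨p0, p1, p2, p3, p4, p5⟩ := h.XB i (Or.inl rfl)
  obtain ⟨-, -, p2', p3', p4', p5'⟩ := h.XB i (Or.inr rfl)
  obtain ⟨q0, q1, q2, q3, q4, q5⟩ := h.XA i' (Or.inl rfl)
  obtain ⟨-, -, q2', q3', q4', q5'⟩ := h.XA i' (Or.inr rfl)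
  have y1 := h.syncj (j := .JB i) trivial
  have y2 := h.syncj (j := .JA i') trivial
  have r1 := h.spa (σ (.JB i))
  have r2 := h.spb (σ (.JB i))
  have r3 := h.spa (σ (.JA i'))
  have r4 := h.spb (σ (.JA i'))
  have mγ2 := NN_mono (pJob z D ι) σ ρ .Jγ 2 hst
  have mγ3 := NN_mono (pJob z D ι) σ ρ .Jγ 3 hst
  have mδ2 := NN_mono (pJob z D ι) σ ρ .Jδ 2 hst
  have mδ3 := NN_mono (pJob z D ι) σ ρ .Jδ 3 hst
  have ma2 := NN_mono (pJob z D ι) σ ρ .Jb 2 hst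
  have ma3 := NN_mono (pJob z D ι) σ ρ .Jb 3 hst
  have l1a := ee_nonneg (pJob z D ι) σ ρ 1 (σ (.JA i')) .Jl1
  have l1b := ee_le (pJob z D ι) σ ρ 1 (σ (.JA i')) .Jl1
  have l2a := ee_nonneg (pJob z D ι) σ ρ 4 (σ (.JB i)) .Jl2
  have l2b := ee_le (pJob z D ι) σ ρ 4 (σ (.JB i)) .Jl2
  have hS := S_const (D := D) (ι := ι) (σ := σ) (ρ := ρ) hst (by omega)
  have hne : ℰ 1 (σ (.JA i')) .Jl1 ≠ ℰ 4 (σ (.JB i)) .Jl2 := by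
    intro heq
    have hJ := J_const (D := D) (ι := ι) (σ := σ) (ρ := ρ) (m := 2) hst (by omega)
    rcases (show ℰ 4 (σ (.JB i)) .Jl2 = 0 ∨ ℰ 4 (σ (.JB i)) .Jl2 = 1 by omega) with h0 | h0
    · rw [h0] at p5; omega
    · rw [h0] at p5; omega
  have L1 : ℰ 1 (σ (.JA i')) .Jl1 = 0 := by omega
  have L2 : ℰ 4 (σ (.JB i)) .Jl2 = 1 := by omega
  refine ⟨L2, ?_⟩
  rw [L2] at p0 p1 p5 p5'
  rw [L1] at q0 q1
  obtain ⟨g1, g2⟩ := h.pair_idx (z + 1 - n) hst (by omega) (by omega) (by omega) (by omega)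
  have az := NN_le (pJob z D ι) σ ρ .Jb 4 (σ (.JA i'))
  have a0 := NN_nonneg (pJob z D ι) σ ρ .Jb 4 (σ (.JB i))
  obtain ⟨l, hl⟩ := h.rb (𝐛 (σ (.JA i')) - 1) (by omega) (by omega)
  obtain ⟨m, hm, hml⟩ := h.mach (j := .Jb l) trivial
  have b1 := (h.bef_b (j := .JB i) trivial l).2 (by omega)
  have b2 := bef (m := 4) (h.bd_start (h.both hm (j := .JA i') trivial)) hml (by omega)
  obtain ⟨-, s1, s3, -, s4, -⟩ := h.X4 hm (h.b4 l) hml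
  have t1 : σ (.JB i) ≤ σ (.Jb l) := by omega
  have t2 : σ (.Jb l) ≤ σ (.JA i') := by omega
  have c1 := NN_mono (pJob z D ι) σ ρ .Jc 2 t1
  have c2 := NN_mono (pJob z D ι) σ ρ .Jc 2 t2
  have c3 := NN_mono (pJob z D ι) σ ρ .Jβ 4 t1
  have c4 := ee_mono (pJob z D ι) σ ρ 4 .Jl2 t1
  have c5 := NN_mono (pJob z D ι) σ ρ .Ja m t1
  have c6 := NN_mono (pJob z D ι) σ ρ .Jδ m t1
  have c7 := NN_lt (pJob z D ι) σ ρ .Jb m l hml (h.pb l) b2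
  rcases hm with rfl | rfl <;> omega

lemma HH.cAB (h : HH z D ι σ ρ) (p q) : σ (.JA p) + pJob z D ι (.JA p) ≤ σ (.JB q) ∨
    σ (.JB q) + pJob z D ι (.JB q) ≤ σ (.JA p) :=
  h.comp (m := 2) (by simp) (h.both (by simp) trivial) (h.both (by simp) trivial)

lemma HH.befA (h : HH z D ι σ ρ) {p i} (hr : 𝐀 (σ (.JA p)) < 𝐀 (σ (.Ja i))) :
    σ (.JA p) + pJob z D ι (.JA p) ≤ σ (.Ja i) := bef (m := 1) (h.bd_start (h.a1 i)) (h.A1 p) hr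
lemma HH.aftA (h : HH z D ι σ ρ) {p i} (hr : 𝐀 (σ (.Ja i)) ≤ 𝐀 (σ (.JA p))) :
    σ (.Ja i) + pJob z D ι (.Ja i) ≤ σ (.JA p) := by
  have h1 := aft (m := 1) (h.bd_start (h.a1 i)) (h.A1 p) (h.A1 p) (h.pA p) hr
  have h2 := h.pA p
  rcases h.comp (j := .JA p) (j' := .Ja i) (by simp) (h.A1 p) (h.a1 i) with h3 | h3 <;> omega
lemma HH.befB (h : HH z D ι σ ρ) {p i} (hr : 𝐁 (σ (.JB p)) < 𝐁 (σ (.Ja i))) :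
    σ (.JB p) + pJob z D ι (.JB p) ≤ σ (.Ja i) := by
  obtain ⟨m, hm, hmi⟩ := h.mach (j := .Ja i) trivial
  exact bef (m := 4) (h.bd_start hmi) (h.both hm trivial) hr
lemma HH.aftB (h : HH z D ι σ ρ) {p i} (hr : 𝐁 (σ (.Ja i)) ≤ 𝐁 (σ (.JB p))) :
    σ (.Ja i) + pJob z D ι (.Ja i) ≤ σ (.JB p) := by
  obtain ⟨m, hm, hmi⟩ := h.mach (j := .Ja i) trivial
  have h1 := aft (m := 4) (h.bd_start hmi) (h.both hm (j := .JB p) trivial) (h.B4 p) (h.pB p) hr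
  have h2 := h.pB p
  rcases h.comp (j := .JB p) (j' := .Ja i) (by simp) (h.both hm trivial) hmi with h3 | h3 <;> omega

lemma HH.range (h : HH z D ι σ ρ) (i) : 1 ≤ 𝐂 (σ (.Ja i)) ∧ 𝐂 (σ (.Ja i)) ≤ z := by
  obtain ⟨kA, kB⟩ := h.key2 i
  obtain ⟨c0, c1⟩ := (h.bds 2 (σ (.Ja i))).2.2.2.2.2.2.2.2.1
  have hlt := NN_lt_card (pJob z D ι) σ ρ .Ja 1 i (h.pa i) le_rfl
  constructor
  · by_contra hc
    obtain ⟨p, hp⟩ := h.rA 0 le_rfl (by omega)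
    obtain ⟨q, hq⟩ := h.rB 0 le_rfl (by omega)
    have h1 := h.aftA (p := p) (i := i) (by omega)
    have h2 := h.aftB (p := q) (i := i) (by omega)
    have a0 := NN_nonneg (pJob z D ι) σ ρ .Ja 1 (σ (.Ja i))
    rcases h.cAB p q with h3 | h3
    · have m1 := NN_mono (pJob z D ι) σ ρ .JB 4 (show σ (.JA p) ≤ σ (.JB q) by omega)
      have m2 := NN_nonneg (pJob z D ι) σ ρ .JB 4 (σ (.JA p))
      have := (h.extA p).1 (by omega)
      have := NN_lt (pJob z D ι) σ ρ .Ja 1 i (h.a1 i) (h.pa i) h1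
      omega
    · have m1 := NN_mono (pJob z D ι) σ ρ .JA 1 (show σ (.JB q) ≤ σ (.JA p) by omega)
      have m2 := NN_nonneg (pJob z D ι) σ ρ .JA 1 (σ (.JB q))
      have := (h.extB q).1 (by omega)
      have := NN_lt (pJob z D ι) σ ρ .Ja 1 i (h.a1 i) (h.pa i) h2
      omega
  · by_contra hc
    obtain ⟨p, hp⟩ := h.rA z (by omega) (by omega)
    obtain ⟨q, hq⟩ := h.rB z (by omega) (by omega)
    have h1 := h.befA (p := p) (i := i) (by omega)
    have h2 := h.befB (p := q) (i := i) (by omega)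
    rcases h.cAB p q with h3 | h3
    · have m1 := NN_lt (pJob z D ι) σ ρ .JA 1 p (h.A1 p) (h.pA p) h3
      have m2 := (h.bds 1 (σ (.JB q))).1
      have := (h.extB q).2 (by omega)
      have := NN_mono (pJob z D ι) σ ρ .Ja 1 (show σ (.JB q) ≤ σ (.Ja i) by omega)
      omega
    · have m1 := NN_lt (pJob z D ι) σ ρ .JB 4 q (h.B4 q) (h.pB q) h3
      have m2 := (h.bds 4 (σ (.JA p))).2.1
      have := (h.extA p).2 (by omega)
      have := NN_mono (pJob z D ι) σ ρ .Ja 1 (show σ (.JA p) ≤ σ (.Ja i) by omega)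
      omega

lemma HH.gap (h : HH z D ι σ ρ) (i) (n : ℤ) (hn : 𝐂 (σ (.Ja i)) = n) :
    (∃ p q, 𝐀 (σ (.JA p)) = n - 1 ∧ 𝐁 (σ (.JA p)) = n ∧ 𝐁 (σ (.JB q)) = n ∧
      ℰ 4 (σ (.JB q)) .Jl2 = 0 ∧ 𝐚 (σ (.JB q)) = 𝐚 (σ (.JA p)) + 1) ∨
    (∃ p q, 𝐁 (σ (.JB p)) = n - 1 ∧ 𝐀 (σ (.JA q)) = n ∧ 𝐁 (σ (.JA q)) = n ∧
      ℰ 4 (σ (.JB p)) .Jl2 = 1 ∧ 𝐚 (σ (.JA q)) = 𝐚 (σ (.JB p)) + 1) := by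
  obtain ⟨kA, kB⟩ := h.key2 i
  obtain ⟨n1, nz⟩ := h.range i
  obtain ⟨pa, hpa⟩ := h.rA (n-1) (by omega) (by omega)
  obtain ⟨pb, hpb⟩ := h.rB (n-1) (by omega) (by omega)
  obtain ⟨qa, hqa⟩ := h.rA n (by omega) (by omega)
  obtain ⟨qb, hqb⟩ := h.rB n (by omega) (by omega)
  have u1 := h.befA (p := pa) (i := i) (by omega)
  have u2 := h.befB (p := pb) (i := i) (by omega)
  have v1 := h.aftA (p := qa) (i := i) (by omega)
  have v2 := h.aftB (p := qb) (i := i) (by omega)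
  have w1 := NN_lt (pJob z D ι) σ ρ .Ja 1 i (h.a1 i) (h.pa i) v1
  have w2 := NN_lt (pJob z D ι) σ ρ .Ja 1 i (h.a1 i) (h.pa i) v2
  have x1 := NN_mono (pJob z D ι) σ ρ .Ja 1 (show σ (.JA pa) ≤ σ (.Ja i) by omega)
  have x2 := NN_mono (pJob z D ι) σ ρ .Ja 1 (show σ (.JB pb) ≤ σ (.Ja i) by omega)
  have y1 := NN_mono (pJob z D ι) σ ρ .JB 4 (show σ (.JA pa) ≤ σ (.Ja i) by omega)
  have y2 := NN_mono (pJob z D ι) σ ρ .JA 1 (show σ (.JB pb) ≤ σ (.Ja i) by omega)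
  have y3 := NN_mono (pJob z D ι) σ ρ .JB 4 (show σ (.Ja i) ≤ σ (.JA qa) by omega)
  have y4 := NN_mono (pJob z D ι) σ ρ .JA 1 (show σ (.Ja i) ≤ σ (.JB qb) by omega)
  rcases h.cAB pa pb with c | c
  · -- P is the B-job
    have m1 := NN_lt (pJob z D ι) σ ρ .JA 1 pa (h.A1 pa) (h.pA pa) c
    rcases h.cAB qa qb with d | d
    · have m2 := NN_mono (pJob z D ι) σ ρ .JB 4 (show σ (.JA qa) ≤ σ (.JB qb) by omega)
      right
      obtain ⟨r1, r2⟩ := h.gapBA pb qa n (by omega) (by omega) (by omega) (by omega) (by omega) (by omega)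
      exact ⟨pb, qa, by omega, by omega, by omega, r1, r2⟩
    · have m2 := NN_mono (pJob z D ι) σ ρ .JA 1 (show σ (.JB qb) ≤ σ (.JA qa) by omega)
      have := h.gapBB pb qb (by omega) (by omega)
      omega
  · have m1 := NN_lt (pJob z D ι) σ ρ .JB 4 pb (h.B4 pb) (h.pB pb) c
    rcases h.cAB qa qb with d | d
    · have m2 := NN_mono (pJob z D ι) σ ρ .JB 4 (show σ (.JA qa) ≤ σ (.JB qb) by omega)
      have := h.gapAA pa qa (by omega) (by omega)
      omega
    · have m2 := NN_mono (pJob z D ι) σ ρ .JA 1 (show σ (.JB qb) ≤ σ (.JA qa) by omega)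
      left
      obtain ⟨r1, r2⟩ := h.gapAB pa qb n (by omega) (by omega) (by omega) (by omega) (by omega) (by omega)
      exact ⟨pa, qb, by omega, by omega, by omega, r1, r2⟩

lemma HH.strict (h : HH z D ι σ ρ) (i i') (hlt : 𝐚 (σ (.Ja i)) < 𝐚 (σ (.Ja i'))) :
    𝐂 (σ (.Ja i)) + 1 ≤ 𝐂 (σ (.Ja i')) := by
  have hb := bef (m := 1) (h.bd_start (h.a1 i')) (h.a1 i) hlt
  have hm := NN_mono (pJob z D ι) σ ρ .Jc 2 (show σ (.Ja i) ≤ σ (.Ja i') by omega)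
  by_contra hc
  obtain ⟨kA, kB⟩ := h.key2 i
  obtain ⟨kA', kB'⟩ := h.key2 i'
  rcases h.gap i _ rfl with ⟨p, q, e1, e2, e3, -, e5⟩ | ⟨p, q, e1, e2, e3, -, e5⟩
  · have u := h.befA (p := p) (i := i) (by omega)
    have v := h.aftB (p := q) (i := i') (by omega)
    have := NN_lt (pJob z D ι) σ ρ .Ja 1 i' (h.a1 i') (h.pa i') v
    have := NN_mono (pJob z D ι) σ ρ .Ja 1 (show σ (.JA p) ≤ σ (.Ja i) by omega)
    omega
  · have u := h.befB (p := p) (i := i) (by omega)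
    have v := h.aftA (p := q) (i := i') (by omega)
    have := NN_lt (pJob z D ι) σ ρ .Ja 1 i' (h.a1 i') (h.pa i') v
    have := NN_mono (pJob z D ι) σ ρ .Ja 1 (show σ (.JB p) ≤ σ (.Ja i) by omega)
    omega

lemma HH.exact_idx (h : HH z D ι σ ρ) (i) : 𝐂 (σ (.Ja i)) = 𝐚 (σ (.Ja i)) + 1 := by
  have lo : ∀ r : ℕ, ∀ i, 𝐚 (σ (.Ja i)) = r → (r:ℤ) + 1 ≤ 𝐂 (σ (.Ja i)) := by
    intro r
    induction r with
    | zero => intro i _; have := h.range i; omega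
    | succ r ih =>
      intro i hi
      have := NN_lt_card (pJob z D ι) σ ρ .Ja 1 i (h.pa i) le_rfl
      obtain ⟨i', hi'⟩ := h.ra r (by omega) (by omega)
      have := ih i' hi'
      have := h.strict i' i (by omega)
      omega
  have up : ∀ s : ℕ, ∀ i, 𝐚 (σ (.Ja i)) + s = z - 1 → 𝐂 (σ (.Ja i)) + s ≤ z := by
    intro s
    induction s with
    | zero => intro i _; have := h.range i; omega
    | succ s ih =>
      intro i hi
      have := NN_nonneg (pJob z D ι) σ ρ .Ja 1 (σ (.Ja i))
      obtain ⟨i', hi'⟩ := h.ra (𝐚 (σ (.Ja i)) + 1) (by omega) (by omega)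
      have := ih i' (by omega)
      have := h.strict i i' (by omega)
      omega
  have h0 := NN_nonneg (pJob z D ι) σ ρ .Ja 1 (σ (.Ja i))
  have h1 := NN_lt_card (pJob z D ι) σ ρ .Ja 1 i (h.pa i) le_rfl
  have h2 := lo (𝐚 (σ (.Ja i))).toNat i (by omega)
  have h3 := up (z - 1 - 𝐚 (σ (.Ja i))).toNat i (by omega)
  omega

lemma HH.sameB (h : HH z D ι σ ρ) {p q} (he : 𝐁 (σ (.JB p)) = 𝐁 (σ (.JB q))) : p = q := by
  by_contra hne
  rcases h.comp (j := .JB p) (j' := .JB q) (by simpa using hne) (h.B4 p) (h.B4 q) with c | c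
  · have := NN_lt (pJob z D ι) σ ρ .JB 4 p (h.B4 p) (h.pB p) c; omega
  · have := NN_lt (pJob z D ι) σ ρ .JB 4 q (h.B4 q) (h.pB q) c; omega

lemma HH.final (h : HH z D ι σ ρ) (x) : 𝛃 (σ (.JB x)) = 𝐚 (σ (.JB x)) := by
  obtain ⟨p0, p1, -, -, -, -⟩ := h.XB x (Or.inl rfl)
  have ba := (h.bds 1 (σ (.JB x))).2.2.1
  have bβ := (h.bds 4 (σ (.JB x))).2.2.2.2.2.2.2.1
  have bl := (h.bds 4 (σ (.JB x))).2.2.2.2.2.2.2.2.2.2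
  have bB := (h.bds 4 (σ (.JB x))).2.1
  have kB := NN_lt_card (pJob z D ι) σ ρ .JB 4 x (h.pB x) le_rfl
  push_cast at kB
  -- lower neighbour
  have low : 0 < 𝐚 (σ (.JB x)) → ∃ i, 𝐂 (σ (.Ja i)) = 𝐚 (σ (.JB x)) ∧
      𝐚 (σ (.JB x)) ≤ 𝐂 (σ (.JB x)) ∧ 𝐚 (σ (.JB x)) ≤ 𝐁 (σ (.JB x)) := by
    intro hpos
    obtain ⟨i, hi⟩ := h.ra (𝐚 (σ (.JB x)) - 1) (by omega) (by omega)
    obtain ⟨m, hm, hmi⟩ := h.mach (j := .Ja i) trivial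
    have hb := bef (m := 1) (h.bd_start (h.both hm (j := .JB x) trivial)) hmi (by omega)
    have hi2 := h.exact_idx i
    have hk := h.key2 i
    have m1 := NN_mono (pJob z D ι) σ ρ .Jc 2 (show σ (.Ja i) ≤ σ (.JB x) by omega)
    have m2 := NN_mono (pJob z D ι) σ ρ .JB 4 (show σ (.Ja i) ≤ σ (.JB x) by omega)
    exact ⟨i, by omega, by omega, by omega⟩
  have high : 𝐚 (σ (.JB x)) < z → ∃ i, 𝐂 (σ (.Ja i)) = 𝐚 (σ (.JB x)) + 1 ∧
      𝐂 (σ (.JB x)) ≤ 𝐚 (σ (.JB x)) + 1 ∧ 𝐁 (σ (.JB x)) ≤ 𝐚 (σ (.JB x)) := by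
    intro hpos
    obtain ⟨i, hi⟩ := h.ra (𝐚 (σ (.JB x))) (by omega) (by omega)
    have hb := (h.bef_a (j := .JB x) trivial i).2 (by omega)
    have hi2 := h.exact_idx i
    have hk := h.key2 i
    have m1 := NN_mono (pJob z D ι) σ ρ .Jc 2 (show σ (.JB x) ≤ σ (.Ja i) by omega)
    have m2 := NN_lt (pJob z D ι) σ ρ .JB 4 x (h.B4 x) (h.pB x) hb
    exact ⟨i, by omega, by omega, by omega⟩
  have hBa : 𝐁 (σ (.JB x)) = 𝐚 (σ (.JB x)) := by
    by_cases c1 : 0 < 𝐚 (σ (.JB x))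
    · obtain ⟨i, -, -, h1⟩ := low c1
      by_cases c2 : 𝐚 (σ (.JB x)) < z
      · obtain ⟨i', -, -, h2⟩ := high c2
        omega
      · omega
    · obtain ⟨i', -, -, h2⟩ := high (by have := h.hz; omega)
      omega
  have hz : (1:ℤ) ≤ z := by have := h.hz; omega
  have hC : 𝐂 (σ (.JB x)) = 𝐚 (σ (.JB x)) ∨ 𝐂 (σ (.JB x)) = 𝐚 (σ (.JB x)) + 1 := by
    by_cases c1 : 0 < 𝐚 (σ (.JB x))
    · obtain ⟨i, -, h1, -⟩ := low c1
      by_cases c2 : 𝐚 (σ (.JB x)) < z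
      · obtain ⟨i', -, h2, -⟩ := high c2
        omega
      · omega
    · obtain ⟨i', -, h2, -⟩ := high (by omega)
      omega
  rcases hC with hC | hC
  · by_cases c1 : 0 < 𝐚 (σ (.JB x))
    · obtain ⟨i, hi, -, -⟩ := low c1
      rcases h.gap i _ hi with ⟨p, q, e1, e2, e3, e4, -⟩ | ⟨p, q, e1, e2, e3, e4, -⟩
      · have := h.sameB (p := q) (q := x) (by omega)
        subst this
        omega
      · rcases h.cAB q x with d | d
        · have := NN_lt (pJob z D ι) σ ρ .JA 1 q (h.A1 q) (h.pA q) d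
          omega
        · have := NN_lt (pJob z D ι) σ ρ .JB 4 x (h.B4 x) (h.pB x) d
          omega
    · omega
  · by_cases c2 : 𝐚 (σ (.JB x)) < z
    · obtain ⟨i, hi, -, -⟩ := high c2
      rcases h.gap i _ hi with ⟨p, q, e1, e2, e3, e4, -⟩ | ⟨p, q, e1, e2, e3, e4, -⟩
      · rcases h.cAB p x with d | d
        · have := NN_mono (pJob z D ι) σ ρ .JB 4 (show σ (.JA p) ≤ σ (.JB x) by omega)
          omega
        · have := NN_mono (pJob z D ι) σ ρ .JA 1 (show σ (.JB x) ≤ σ (.JA p) by omega)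
          omega
      · have := h.sameB (p := p) (q := x) (by omega)
        subst this
        omega
    · omega

end
end CB


/-- Equation (2): at the start of every job `B' ∈ B` we have
`#c − #λ₂ = #A − #λ₂ = #β = #a = #b`. -/
theorem counts_at_B_jobs
    (z D : ℕ) (ι : Fin (3*z) → ℕ)
    (hz : 0 < z) (hDpos : 0 < D)
    (hιpos : ∀ i, 0 < ι i)
    (hsum : ∑ i, ι i = z * D)
    (hlow : ∀ i, D < 4 * ι i)
    (hhigh : ∀ i, 2 * ι i < D)
    (hD : 4*z*(7*z+1) < D)
    (σ : Job z → ℕ) (ρ : Job z → Finset ℕ)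
    (hfeas : Feasible 4 (pJob z D ι) (qJob z) σ ρ)
    (hmk : makespan (pJob z D ι) σ = Wval z D)
    (hnf : NormalForm ρ) :
    ∀ B' ∈ sB z,
      (cnt (pJob z D ι) σ (sc z) B' : ℤ) - cnt (pJob z D ι) σ {Job.Jl2} B' =
        (cnt (pJob z D ι) σ (sA z) B' : ℤ) - cnt (pJob z D ι) σ {Job.Jl2} B' ∧
      (cnt (pJob z D ι) σ (sA z) B' : ℤ) - cnt (pJob z D ι) σ {Job.Jl2} B' =
        (cnt (pJob z D ι) σ (sβ z) B' : ℤ) ∧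
      cnt (pJob z D ι) σ (sβ z) B' = cnt (pJob z D ι) σ (sa z) B' ∧
      cnt (pJob z D ι) σ (sa z) B' = cnt (pJob z D ι) σ (sb z) B' := by
  intro B' hB'
  have h : CB.HH z D ι σ ρ := ⟨hz, hD, hsum, hfeas, fun j => by
    rw [← hmk]
    exact Finset.le_sup (f := fun j => σ j + pJob z D ι j) (Finset.mem_univ j), hnf⟩
  obtain ⟨x, -, rfl⟩ := Finset.mem_image.1 hB'
  have hA := CB.cnt_eq (pJob z D ι) σ ρ Job.JA (fun a b e => by injection e) 1 h.A1 (.JB x)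
  have hc := CB.cnt_eq (pJob z D ι) σ ρ Job.Jc (fun a b e => by injection e) 2
    (fun i => h.both (Or.inl rfl) trivial) (.JB x)
  have ha := CB.cnt_eq (pJob z D ι) σ ρ Job.Ja (fun a b e => by injection e) 1 h.a1 (.JB x)
  have hb := CB.cnt_eq (pJob z D ι) σ ρ Job.Jb (fun a b e => by injection e) 4 h.b4 (.JB x)
  have hβ := CB.cnt_eq (pJob z D ι) σ ρ Job.Jβ (fun a b e => by injection e) 4 h.β4 (.JB x)
  have hl : (cnt (pJob z D ι) σ {Job.Jl2} (.JB x) : ℤ) = CB.ee (pJob z D ι) σ ρ 4 (σ (.JB x)) .Jl2 := by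
    unfold cnt CB.ee
    rw [Finset.card_filter, Finset.sum_singleton]
    simp [h.l2]
  obtain ⟨p0, p1, -, -, -, -⟩ := h.XB x (Or.inl rfl)
  have hs := h.syncj (j := .JB x) trivial
  have hf := h.final x
  unfold sc sA sβ sa sb
  refine ⟨by omega, by omega, by omega, by omega⟩
end

section
/- In every normal-form feasible schedule of the constructed instance with makespan W, for every job b' ∈ b the following counts at the start time of b' coincide: #_{b'} A = #_{b'} β + #_{b'} {λ_2} = #_{b'} c. -/
def jobEquiv (z : ℕ) : Job z ≃ (Fin (z+1) ⊕ Fin (z+1) ⊕ Fin z ⊕ Fin z ⊕ Fin (z+1) ⊕ Fin z ⊕ Fin z ⊕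
    Fin z ⊕ Fin z ⊕ Unit ⊕ Unit ⊕ Fin (3*z)) where
  toFun
    | .JA i => .inl i
    | .JB i => .inr (.inl i)
    | .Ja i => .inr (.inr (.inl i))
    | .Jb i => .inr (.inr (.inr (.inl i)))
    | .Jc i => .inr (.inr (.inr (.inr (.inl i))))
    | .Jα i => .inr (.inr (.inr (.inr (.inr (.inl i)))))
    | .Jβ i => .inr (.inr (.inr (.inr (.inr (.inr (.inl i))))))
    | .Jγ i => .inr (.inr (.inr (.inr (.inr (.inr (.inr (.inl i)))))))
    | .Jδ i => .inr (.inr (.inr (.inr (.inr (.inr (.inr (.inr (.inl i))))))))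
    | .Jl1 => .inr (.inr (.inr (.inr (.inr (.inr (.inr (.inr (.inr (.inl ())))))))))
    | .Jl2 => .inr (.inr (.inr (.inr (.inr (.inr (.inr (.inr (.inr (.inr (.inl ()))))))))))
    | .Jpart i => .inr (.inr (.inr (.inr (.inr (.inr (.inr (.inr (.inr (.inr (.inr i))))))))))
  invFun
    | .inl i => .JA i
    | .inr (.inl i) => .JB i
    | .inr (.inr (.inl i)) => .Ja i
    | .inr (.inr (.inr (.inl i))) => .Jb i
    | .inr (.inr (.inr (.inr (.inl i)))) => .Jc i
    | .inr (.inr (.inr (.inr (.inr (.inl i))))) => .Jα i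
    | .inr (.inr (.inr (.inr (.inr (.inr (.inl i)))))) => .Jβ i
    | .inr (.inr (.inr (.inr (.inr (.inr (.inr (.inl i))))))) => .Jγ i
    | .inr (.inr (.inr (.inr (.inr (.inr (.inr (.inr (.inl i)))))))) => .Jδ i
    | .inr (.inr (.inr (.inr (.inr (.inr (.inr (.inr (.inr (.inl ()))))))))) => .Jl1
    | .inr (.inr (.inr (.inr (.inr (.inr (.inr (.inr (.inr (.inr (.inl ())))))))))) => .Jl2
    | .inr (.inr (.inr (.inr (.inr (.inr (.inr (.inr (.inr (.inr (.inr i)))))))))) => .Jpart i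
  left_inv j := by cases j <;> rfl
  right_inv j := by
    rcases j with i|i|i|i|i|i|i|i|i|i|i|i <;> rfl

theorem sum_job {z : ℕ} (f : Job z → ℕ) : ∑ j, f j =
    (∑ i, f (.JA i)) + (∑ i, f (.JB i)) + (∑ i, f (.Ja i)) + (∑ i, f (.Jb i)) + (∑ i, f (.Jc i))
    + (∑ i, f (.Jα i)) + (∑ i, f (.Jβ i)) + (∑ i, f (.Jγ i)) + (∑ i, f (.Jδ i))
    + f .Jl1 + f .Jl2 + (∑ i, f (.Jpart i)) := by
  rw [← Equiv.sum_comp (jobEquiv z).symm]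
  simp only [Fintype.sum_sum_type, jobEquiv, Equiv.coe_fn_symm_mk, Finset.univ_unique,
    Finset.sum_singleton]
  ring

theorem packing {J : Type} [DecidableEq J] (p σ : J → ℕ) (S : Finset J) (lo hi : ℕ)
    (hd : ∀ j ∈ S, ∀ j' ∈ S, j ≠ j' → σ j + p j ≤ σ j' ∨ σ j' + p j' ≤ σ j)
    (hlo : ∀ j ∈ S, lo ≤ σ j) (hhi : ∀ j ∈ S, σ j + p j ≤ hi) :
    ∑ j ∈ S, p j ≤ hi - lo := by
  have h1 : (S.biUnion fun j => Finset.Ico (σ j) (σ j + p j)).card = ∑ j ∈ S, p j := by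
    rw [Finset.card_biUnion]
    · simp
    · intro j hj j' hj' hne
      change Disjoint (Finset.Ico _ _) (Finset.Ico _ _)
      rw [Finset.disjoint_left]
      intro x hx hx'
      simp only [Finset.mem_Ico] at hx hx'
      have := hd j hj j' hj' hne
      omega
  rw [← h1, ← Nat.card_Ico]
  apply Finset.card_le_card
  intro x hx
  simp only [Finset.mem_biUnion, Finset.mem_Ico] at hx ⊢
  obtain ⟨j, hj, hx⟩ := hx
  have := hlo j hj
  have := hhi j hj
  omega

theorem exact_before {J : Type} [Fintype J] [DecidableEq J] (p σ : J → ℕ) (M : J → Prop)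
    [DecidablePred M] (W : ℕ)
    (hd : ∀ j j', M j → M j' → j ≠ j' → σ j + p j ≤ σ j' ∨ σ j' + p j' ≤ σ j)
    (hW : ∀ j, σ j + p j ≤ W)
    (hload : ∑ j, (if M j then p j else 0) = W) (b : J) (hb : M b) (hp : 0 < p b) :
    ∑ j, (if M j ∧ σ j + p j ≤ σ b then p j else 0) = σ b := by
  have h1 : ∑ j ∈ Finset.univ.filter (fun j => M j ∧ σ j + p j ≤ σ b), p j ≤ σ b - 0 := by
    apply packing p σ
    · intro j hj j' hj' hne
      simp only [Finset.mem_filter] at hj hj'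
      exact hd j j' hj.2.1 hj'.2.1 hne
    · simp
    · intro j hj
      simp only [Finset.mem_filter] at hj
      exact hj.2.2
  have h2 : ∑ j ∈ Finset.univ.filter (fun j => M j ∧ ¬ σ j + p j ≤ σ b), p j ≤ W - σ b := by
    apply packing p σ
    · intro j hj j' hj' hne
      simp only [Finset.mem_filter] at hj hj'
      exact hd j j' hj.2.1 hj'.2.1 hne
    · intro j hj
      simp only [Finset.mem_filter] at hj
      by_cases h : j = b
      · rw [h]
      · have := hd j b hj.2.1 hb h
        omega
    · intro j hj
      exact hW j
  rw [Finset.sum_filter] at h1 h2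
  have h3 : ∑ j, (if M j then p j else 0) = ∑ j, (if M j ∧ σ j + p j ≤ σ b then p j else 0)
      + ∑ j, (if M j ∧ ¬ σ j + p j ≤ σ b then p j else 0) := by
    rw [← Finset.sum_add_distrib]
    apply Finset.sum_congr rfl
    intro j _
    by_cases h : M j <;> by_cases h' : σ j + p j ≤ σ b <;> simp [h, h']
  have := hW b
  omega

theorem digit_step (D d r : ℤ) (h : d + D * r = 0) (h1 : d < D) (h2 : -D < d) :
    d = 0 ∧ r = 0 := by
  have hd : D ∣ d := ⟨-r, by linarith⟩
  have h0 : d = 0 := Int.eq_zero_of_abs_lt_dvd hd (abs_lt.mpr ⟨h2, h1⟩)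
  refine ⟨h0, ?_⟩
  have hD : 0 < D := by linarith
  rw [h0, zero_add] at h
  rcases mul_eq_zero.mp h with h | h
  · omega
  · exact h

theorem digits (D e d2 d3 d4 d5 d6 d7 d8 : ℤ)
    (h : e + d2 * D^2 + d3 * D^3 + d4 * D^4 + d5 * D^5 + d6 * D^6 + d7 * D^7 + d8 * D^8 = 0)
    (he : e < D^2) (he' : -D^2 < e) (h2 : d2 < D) (h2' : -D < d2) (h3 : d3 < D) (h3' : -D < d3)
    (h4 : d4 < D) (h4' : -D < d4) (h5 : d5 < D) (h5' : -D < d5) (h6 : d6 < D) (h6' : -D < d6)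
    (h7 : d7 < D) (h7' : -D < d7) : d2 = 0 ∧ d8 = 0 := by
  obtain ⟨_, r1⟩ := digit_step (D^2) e
    (d2 + D * (d3 + D * (d4 + D * (d5 + D * (d6 + D * (d7 + D * d8))))))
    (by linear_combination h) he he'
  obtain ⟨r2, r1⟩ := digit_step D _ _ r1 h2 h2'
  obtain ⟨_, r1⟩ := digit_step D _ _ r1 h3 h3'
  obtain ⟨_, r1⟩ := digit_step D _ _ r1 h4 h4'
  obtain ⟨_, r1⟩ := digit_step D _ _ r1 h5 h5'
  obtain ⟨_, r1⟩ := digit_step D _ _ r1 h6 h6'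
  obtain ⟨_, r1⟩ := digit_step D _ _ r1 h7 h7'
  exact ⟨r2, r1⟩

theorem cnt_image {z n : ℕ} (p σ : Job z → ℕ) (f : Fin n → Job z) (hf : Function.Injective f)
    (b : Job z) : cnt p σ (Finset.univ.image f) b =
      (Finset.univ.filter fun i => σ (f i) + p (f i) ≤ σ b).card := by
  unfold cnt
  rw [Finset.filter_image, Finset.card_image_of_injective _ hf]

theorem sum_ite_const {n : ℕ} (Q : Fin n → Prop) [DecidablePred Q] (c : ℕ) :
    ∑ i, (if Q i then c else 0) = (Finset.univ.filter Q).card * c := by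
  rw [← Finset.sum_filter, Finset.sum_const, smul_eq_mul]

theorem card_le_n {n : ℕ} (Q : Fin n → Prop) [DecidablePred Q] :
    (Finset.univ.filter Q).card ≤ n := by
  simpa using Finset.card_filter_le (Finset.univ : Finset (Fin n)) Q

theorem sum_ite_bound {n : ℕ} (Q : Fin n → Prop) [DecidablePred Q] (f : Fin n → ℕ) (B : ℕ)
    (h : ∀ i, f i ≤ B) : ∑ i, (if Q i then f i else 0) ≤ n * B := by
  calc _ ≤ ∑ i : Fin n, B := Finset.sum_le_sum fun i _ => by
        split_ifs
        · exact h i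
        · exact Nat.zero_le _
    _ = n * B := by simp

theorem final_arith (z D t y P G Sc Sγ Sδ nγ nδ na nb nb4 nβ nA nB nc nl : ℕ) (hz : 0 < z)
    (hD : 4*z*(7*z+1) < D) (hy : y ≤ 4 * z)
    (E4 : nB * D^3 + nb4 * (D^5 + D^6 + 3*z*D^7) + nβ * (D^2 + D^4 + y*D^7 + D^8)
      + nl * (D^2 + 2*z*D^7 + D^8) = t)
    (Ek : nA * D^2 + nB * D^3 + na * (D^4 + D^6 + 3*z*D^7) + nb * (D^5 + D^6 + 3*z*D^7)
      + (Sc * D^7 + nc * D^8) + G + (Sδ * D^7 + nδ * D^4) + P = t)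
    (hγ : G + nγ * D = Sγ * D^7 + nγ * D^5) (hP : P ≤ z * D)
    (gc : Sc ≤ (z+1) * (2*z)) (gγ : Sγ ≤ z * (3*z)) (gδ : Sδ ≤ z * (3*z))
    (cγ : nγ ≤ z) (cδ : nδ ≤ z) (ca : na ≤ z) (cb : nb ≤ z) (cb4 : nb4 ≤ z) (cβ : nβ ≤ z)
    (cA : nA ≤ z + 1) (cl : nl ≤ 1) : nA = nβ + nl ∧ nβ + nl = nc := by
  have e1 : 3 * z * na ≤ 3 * z * z := Nat.mul_le_mul_left _ ca
  have e2 : 3 * z * nb ≤ 3 * z * z := Nat.mul_le_mul_left _ cb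
  have e3 : 3 * z * nb4 ≤ 3 * z * z := Nat.mul_le_mul_left _ cb4
  have e4 : nβ * y ≤ z * (4 * z) := Nat.mul_le_mul cβ hy
  have e5 : 2 * z * nl ≤ 2 * z * 1 := Nat.mul_le_mul_left _ cl
  have e6 : nγ * D ≤ z * D := Nat.mul_le_mul_right _ cγ
  have e8 : z * 1 ≤ z * z := Nat.mul_le_mul_left _ hz
  have hD' : 28 * (z * z) + 4 * z < D := by linarith
  have e7 : z * D < D^2 := by
    rw [pow_two]; exact Nat.mul_lt_mul_of_pos_right (by omega) (by omega)
  have hs : 3 * z * na + 3 * z * nb + Sc + Sγ + Sδ < D := by nlinarith only [e1,e2,gc,gγ,gδ,hD',hz]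
  have hs' : 3 * z * nb4 + nβ * y + 2 * z * nl < D := by nlinarith only [e3,e4,e5,hD',hz,e8]
  have hzD : 32 * z < D := by omega
  clear gc gγ gδ e1 e2 e3 e4 e5 hD hD' e8
  zify at *
  have p1 : (0:ℤ) ≤ P := by positivity
  have p2 : (0:ℤ) ≤ nγ * D := by positivity
  have p3 : (0:ℤ) ≤ 3 * z * na + 3 * z * nb + Sc + Sγ + Sδ := by positivity
  have p4 : (0:ℤ) ≤ 3 * z * nb4 + nβ * y + 2 * z * nl := by positivity
  have key := digits (D:ℤ) (P - nγ * D) (nA - nβ - nl) 0 (na + nδ - nβ) (nb + nγ - nb4)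
    (na + nb - nb4) (3 * z * na + 3 * z * nb + Sc + Sγ + Sδ - (3 * z * nb4 + nβ * y + 2 * z * nl))
    (nc - nβ - nl) (by linear_combination Ek - E4 - hγ)
    (by linarith) (by linarith) (by omega) (by omega) (by omega) (by omega)
    (by omega) (by omega) (by omega) (by omega) (by omega) (by omega)
    (by linarith) (by linarith)
  omega

set_option maxHeartbeats 1000000 in
/-- Equation (4): at the start of every job `b' ∈ b` we have `#A = #β + #λ₂ = #c`. -/
theorem counts_at_b_jobs
    (z D : ℕ) (ι : Fin (3*z) → ℕ)
    (hz : 0 < z) (hDpos : 0 < D)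
    (hιpos : ∀ i, 0 < ι i)
    (hsum : ∑ i, ι i = z * D)
    (hlow : ∀ i, D < 4 * ι i)
    (hhigh : ∀ i, 2 * ι i < D)
    (hD : 4*z*(7*z+1) < D)
    (σ : Job z → ℕ) (ρ : Job z → Finset ℕ)
    (hfeas : Feasible 4 (pJob z D ι) (qJob z) σ ρ)
    (hmk : makespan (pJob z D ι) σ = Wval z D)
    (hnf : NormalForm ρ) :
    ∀ b' ∈ sb z,
      cnt (pJob z D ι) σ (sA z) b' =
        cnt (pJob z D ι) σ (sβ z) b' + cnt (pJob z D ι) σ {Job.Jl2} b' ∧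
      cnt (pJob z D ι) σ (sβ z) b' + cnt (pJob z D ι) σ {Job.Jl2} b' =
        cnt (pJob z D ι) σ (sc z) b' := by
  intro b' hb'
  obtain ⟨ib, _, rfl⟩ := Finset.mem_image.mp hb'
  obtain ⟨hsub, hcard, hdis⟩ := hfeas
  obtain ⟨n1, n4, n23, n1of⟩ := hnf
  set p := pJob z D ι with hp
  have hD5 : D ≤ D^5 := Nat.le_self_pow (by norm_num) D
  have hW : ∀ j, σ j + p j ≤ Wval z D := fun j => by
    rw [← hmk]
    exact Finset.le_sup (f := fun j => σ j + p j) (Finset.mem_univ j)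
  have hd : ∀ m j j', m ∈ ρ j → m ∈ ρ j' → j ≠ j' → σ j + p j ≤ σ j' ∨ σ j' + p j' ≤ σ j :=
    fun m j j' h h' hne => hdis j j' hne ⟨m, Finset.mem_inter.mpr ⟨h, h'⟩⟩
  -- single-machine jobs
  have single : ∀ j m m', qJob z j = 1 → m ∈ ρ j → m' ∈ ρ j → m = m' := fun j m m' hq h h' =>
    Finset.card_le_one.mp (by rw [hcard j, hq]) m h m' h'
  have hα : ∀ i m, (m = 2 ∨ m = 3) → m ∉ ρ (.Jα i) := fun i m hm h => by
    have := single _ _ _ rfl h ((n1 (.Jα i)).mpr trivial)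
    omega
  have hβ : ∀ i m, (m = 2 ∨ m = 3) → m ∉ ρ (.Jβ i) := fun i m hm h => by
    have := single _ _ _ rfl h ((n4 (.Jβ i)).mpr trivial)
    omega
  have hl1 : ∀ m, (m = 2 ∨ m = 3) → m ∉ ρ .Jl1 := fun m hm h => by
    have := single _ _ _ rfl h ((n1 .Jl1).mpr trivial)
    omega
  have hl2 : ∀ m, (m = 2 ∨ m = 3) → m ∉ ρ .Jl2 := fun m hm h => by
    have := single _ _ _ rfl h ((n4 .Jl2).mpr trivial)
    omega
  -- load of machine 4
  have load4 : ∑ j, (if 4 ∈ ρ j then p j else 0) = Wval z D := by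
    rw [sum_job]
    simp only [n4, M4Jobs, if_true, if_false, Finset.sum_const_zero, hp, pJob, Finset.sum_const,
      Finset.card_univ, Fintype.card_fin, smul_eq_mul, Wval]
    obtain ⟨y, hy⟩ : ∃ y, 4 * z - 1 = y ∧ 4 * z = y + 1 := ⟨4*z-1, rfl, by omega⟩
    rw [hy.1]
    zify at hy ⊢
    have : (y:ℤ) = 4 * z - 1 := by linarith [hy.2]
    rw [this]
    ring
  have load_le : ∀ m, ∑ j, (if m ∈ ρ j then p j else 0) ≤ Wval z D := fun m => by
    rw [← Finset.sum_filter]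
    refine packing p σ _ 0 _ ?_ (by simp) (fun j _ => hW j)
    intro j hj j' hj' hne
    simp only [Finset.mem_filter] at hj hj'
    exact hd m j j' hj.2 hj'.2 hne
  have load23 : ∑ j, (if 2 ∈ ρ j then p j else 0) + ∑ j, (if 3 ∈ ρ j then p j else 0)
      = 2 * Wval z D := by
    rw [← Finset.sum_add_distrib, sum_job]
    have one : ∀ j, OneM23 j → (if 2 ∈ ρ j then p j else 0) + (if 3 ∈ ρ j then p j else 0) = p j :=
      fun j hj => by
        have := n1of j hj
        by_cases h3 : 3 ∈ ρ j <;> simp [this, h3]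
    have two : ∀ j, BothM23 j → (if 2 ∈ ρ j then p j else 0) + (if 3 ∈ ρ j then p j else 0)
        = 2 * p j := fun j hj => by
        have := n23 j hj
        simp [this.1, this.2, two_mul]
    rw [Finset.sum_congr rfl (fun i _ => two (.JA i) trivial),
      Finset.sum_congr rfl (fun i _ => two (.JB i) trivial),
      Finset.sum_congr rfl (fun i _ => two (.Jc i) trivial),
      Finset.sum_congr rfl (fun i _ => one (.Ja i) trivial),
      Finset.sum_congr rfl (fun i _ => one (.Jb i) trivial),
      Finset.sum_congr rfl (fun i _ => one (.Jγ i) trivial),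
      Finset.sum_congr rfl (fun i _ => one (.Jδ i) trivial),
      Finset.sum_congr rfl (fun i _ => one (.Jpart i) trivial)]
    simp only [hα _ 2 (by simp), hα _ 3 (by simp), hβ _ 2 (by simp), hβ _ 3 (by simp),
      hl1 2 (by simp), hl1 3 (by simp), hl2 2 (by simp), hl2 3 (by simp), if_false, add_zero,
      Finset.sum_const_zero]
    simp only [hp, pJob, hsum, Finset.sum_const,
      Finset.card_univ, Fintype.card_fin, smul_eq_mul, Wval]
    have comb : ∑ i : Fin (z+1), 2 * ((z + i.val)*D^7 + D^8)
        + ∑ i : Fin z, (D^5 + (3*z - (i.val+1))*D^7 - D)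
        + ∑ i : Fin z, (D^4 + (3*z - (i.val+1))*D^7) + z * D
        = 2 * (z * D^7 + D^8) + z * (2 * D^8 + D^5 + D^4 + 8 * z * D^7) := by
      rw [Fin.sum_univ_succ]
      have : ∑ i : Fin z, (2 * ((z + i.succ.val)*D^7 + D^8)
          + (D^5 + (3*z - (i.val+1))*D^7 - D)
          + (D^4 + (3*z - (i.val+1))*D^7) + D)
          = ∑ i : Fin z, (2 * D^8 + D^5 + D^4 + 8 * z * D^7) := by
        apply Finset.sum_congr rfl
        intro i _
        obtain ⟨y, hy, hy'⟩ : ∃ y, 3 * z - (i.val + 1) = y ∧ z + (i.val + 1) + y = 4 * z :=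
          ⟨_, rfl, by omega⟩
        rw [hy, Fin.val_succ]
        have : D^5 + y * D^7 - D + D = D^5 + y * D^7 := by omega
        have e : 2 * ((z + (i.val+1)) * D^7) + y * D^7 + y * D^7 = 8 * z * D^7 := by
          have : 2 * ((z + (i.val+1)) * D^7) + y * D^7 + y * D^7
            = 2 * (z + (i.val + 1) + y) * D^7 := by ring
          rw [this, hy']; ring
        omega
      simp only [Finset.sum_add_distrib, Finset.sum_const, Finset.card_univ, Fintype.card_fin,
        smul_eq_mul] at this ⊢
      simp only [Fin.val_zero, add_zero]
      linarith
    linear_combination comb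
  have load2 : ∑ j, (if 2 ∈ ρ j then p j else 0) = Wval z D := by
    have := load_le 2; have := load_le 3; omega
  have load3 : ∑ j, (if 3 ∈ ρ j then p j else 0) = Wval z D := by
    have := load_le 2; have := load_le 3; omega
  have hpb : 0 < p (.Jb ib) := by
    simp only [hp, pJob]; positivity
  have b4 : 4 ∈ ρ (.Jb ib) := (n4 (.Jb ib)).mpr trivial
  obtain ⟨k, hk, hkb, hload⟩ : ∃ k, (k = 2 ∨ k = 3) ∧ k ∈ ρ (.Jb ib) ∧
      ∑ j, (if k ∈ ρ j then p j else 0) = Wval z D := by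
    by_cases h3 : 3 ∈ ρ (.Jb ib)
    · exact ⟨3, by simp, h3, load3⟩
    · exact ⟨2, by simp, (n1of (.Jb ib) trivial).mpr h3, load2⟩
  have E4 := exact_before p σ (fun j => 4 ∈ ρ j) _ (fun j j' => hd 4 j j') hW load4 _ b4 hpb
  have Ek := exact_before p σ (fun j => k ∈ ρ j) _ (fun j j' => hd k j j') hW hload _ hkb hpb
  have both : ∀ j, BothM23 j → k ∈ ρ j := fun j hj => by
    rcases hk with rfl | rfl
    · exact (n23 j hj).1
    · exact (n23 j hj).2
  unfold sA sβ sc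
  rw [cnt_image p σ Job.JA (fun _ _ h => by injection h),
    cnt_image p σ Job.Jβ (fun _ _ h => by injection h),
    cnt_image p σ Job.Jc (fun _ _ h => by injection h)]
  set t := σ (.Jb ib) with ht
  have hcl : cnt p σ {Job.Jl2} (.Jb ib) = if σ .Jl2 + p .Jl2 ≤ t then 1 else 0 := by
    unfold cnt
    rw [Finset.filter_singleton]
    split_ifs <;> simp
  rw [hcl]
  rw [sum_job] at E4 Ek
  simp only [n4, M4Jobs, true_and, false_and, if_false, Finset.sum_const_zero, zero_add,
    add_zero] at E4
  simp only [both (.JA _) trivial, both (.JB _) trivial, both (.Jc _) trivial, hα _ k hk,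
    hβ _ k hk, hl1 k hk, hl2 k hk, true_and, false_and, if_false, Finset.sum_const_zero,
    add_zero] at Ek
  have pA : ∀ i, p (.JA i) = D^2 := fun _ => rfl
  have pB : ∀ i, p (.JB i) = D^3 := fun _ => rfl
  have pa : ∀ i, p (.Ja i) = D^4 + D^6 + 3*z*D^7 := fun _ => rfl
  have pb : ∀ i, p (.Jb i) = D^5 + D^6 + 3*z*D^7 := fun _ => rfl
  have pβ : ∀ i, p (.Jβ i) = D^2 + D^4 + (4*z-1)*D^7 + D^8 := fun _ => rfl
  have pl2 : p .Jl2 = D^2 + 2*z*D^7 + D^8 := rfl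
  have hc : ∑ i, (if σ (.Jc i) + p (.Jc i) ≤ t then p (.Jc i) else 0) =
      (∑ i : Fin (z+1), (if σ (.Jc i) + p (.Jc i) ≤ t then z + i.val else 0)) * D^7
      + (Finset.univ.filter fun i => σ (.Jc i) + p (.Jc i) ≤ t).card * D^8 := by
    rw [← sum_ite_const, Finset.sum_mul, ← Finset.sum_add_distrib]
    refine Finset.sum_congr rfl fun i _ => ?_
    split_ifs
    · rfl
    · simp
  have hγ : ∑ i, (if k ∈ ρ (.Jγ i) ∧ σ (.Jγ i) + p (.Jγ i) ≤ t then p (.Jγ i) else 0)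
      + (Finset.univ.filter fun i => k ∈ ρ (.Jγ i) ∧ σ (.Jγ i) + p (.Jγ i) ≤ t).card * D =
      (∑ i : Fin z, (if k ∈ ρ (.Jγ i) ∧ σ (.Jγ i) + p (.Jγ i) ≤ t then 3*z - (i.val+1) else 0)) * D^7
      + (Finset.univ.filter fun i => k ∈ ρ (.Jγ i) ∧ σ (.Jγ i) + p (.Jγ i) ≤ t).card * D^5 := by
    rw [← sum_ite_const, ← sum_ite_const, Finset.sum_mul, ← Finset.sum_add_distrib,
      ← Finset.sum_add_distrib]
    refine Finset.sum_congr rfl fun i _ => ?_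
    split_ifs
    · have : p (.Jγ i) = D^5 + (3*z - (i.val+1))*D^7 - D := rfl
      omega
    · simp
  have hδ : ∑ i, (if k ∈ ρ (.Jδ i) ∧ σ (.Jδ i) + p (.Jδ i) ≤ t then p (.Jδ i) else 0) =
      (∑ i : Fin z, (if k ∈ ρ (.Jδ i) ∧ σ (.Jδ i) + p (.Jδ i) ≤ t then 3*z - (i.val+1) else 0)) * D^7
      + (Finset.univ.filter fun i => k ∈ ρ (.Jδ i) ∧ σ (.Jδ i) + p (.Jδ i) ≤ t).card * D^4 := by
    rw [← sum_ite_const, Finset.sum_mul, ← Finset.sum_add_distrib]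
    refine Finset.sum_congr rfl fun i _ => ?_
    split_ifs
    · have : p (.Jδ i) = D^4 + (3*z - (i.val+1))*D^7 := rfl
      omega
    · simp
  have hP : ∑ i, (if k ∈ ρ (.Jpart i) ∧ σ (.Jpart i) + p (.Jpart i) ≤ t then p (.Jpart i) else 0)
      ≤ z * D := by
    rw [← hsum]
    refine Finset.sum_le_sum fun i _ => ?_
    split_ifs
    · exact le_rfl
    · exact Nat.zero_le _
  have gc := sum_ite_bound (fun i : Fin (z+1) => σ (.Jc i) + p (.Jc i) ≤ t)
    (fun i => z + i.val) (2*z) (fun i => by omega)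
  have gγ := sum_ite_bound (fun i : Fin z => k ∈ ρ (.Jγ i) ∧ σ (.Jγ i) + p (.Jγ i) ≤ t)
    (fun i => 3*z - (i.val+1)) (3*z) (fun i => by omega)
  have gδ := sum_ite_bound (fun i : Fin z => k ∈ ρ (.Jδ i) ∧ σ (.Jδ i) + p (.Jδ i) ≤ t)
    (fun i => 3*z - (i.val+1)) (3*z) (fun i => by omega)
  have cγ := card_le_n (fun i : Fin z => k ∈ ρ (.Jγ i) ∧ σ (.Jγ i) + p (.Jγ i) ≤ t)
  have cδ := card_le_n (fun i : Fin z => k ∈ ρ (.Jδ i) ∧ σ (.Jδ i) + p (.Jδ i) ≤ t)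
  have ca := card_le_n (fun i : Fin z => k ∈ ρ (.Ja i) ∧ σ (.Ja i) + p (.Ja i) ≤ t)
  have cb := card_le_n (fun i : Fin z => k ∈ ρ (.Jb i) ∧ σ (.Jb i) + p (.Jb i) ≤ t)
  have cb4 := card_le_n (fun i : Fin z => σ (.Jb i) + p (.Jb i) ≤ t)
  have cβ := card_le_n (fun i : Fin z => σ (.Jβ i) + p (.Jβ i) ≤ t)
  have cA := card_le_n (fun i : Fin (z+1) => σ (.JA i) + p (.JA i) ≤ t)
  have hl : (if σ .Jl2 + p .Jl2 ≤ t then p .Jl2 else 0)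
      = (if σ .Jl2 + p .Jl2 ≤ t then 1 else 0) * (D^2 + 2*z*D^7 + D^8) := by
    split_ifs
    · rw [pl2, one_mul]
    · simp
  have cl : (if σ .Jl2 + p .Jl2 ≤ t then 1 else 0) ≤ 1 := by split_ifs <;> simp
  have fA : ∑ i, (if σ (.JA i) + p (.JA i) ≤ t then p (.JA i) else 0) = _ :=
    sum_ite_const (fun i => σ (.JA i) + p (.JA i) ≤ t) (D^2)
  have fB : ∑ i, (if σ (.JB i) + p (.JB i) ≤ t then p (.JB i) else 0) = _ :=
    sum_ite_const (fun i => σ (.JB i) + p (.JB i) ≤ t) (D^3)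
  have fa : ∑ i, (if k ∈ ρ (.Ja i) ∧ σ (.Ja i) + p (.Ja i) ≤ t then p (.Ja i) else 0) = _ :=
    sum_ite_const (fun i => k ∈ ρ (.Ja i) ∧ σ (.Ja i) + p (.Ja i) ≤ t) (D^4 + D^6 + 3*z*D^7)
  have fb : ∑ i, (if k ∈ ρ (.Jb i) ∧ σ (.Jb i) + p (.Jb i) ≤ t then p (.Jb i) else 0) = _ :=
    sum_ite_const (fun i => k ∈ ρ (.Jb i) ∧ σ (.Jb i) + p (.Jb i) ≤ t) (D^5 + D^6 + 3*z*D^7)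
  have fb4 : ∑ i, (if σ (.Jb i) + p (.Jb i) ≤ t then p (.Jb i) else 0) = _ :=
    sum_ite_const (fun i => σ (.Jb i) + p (.Jb i) ≤ t) (D^5 + D^6 + 3*z*D^7)
  have fβ : ∑ i, (if σ (.Jβ i) + p (.Jβ i) ≤ t then p (.Jβ i) else 0) = _ :=
    sum_ite_const (fun i => σ (.Jβ i) + p (.Jβ i) ≤ t) (D^2 + D^4 + (4*z-1)*D^7 + D^8)
  rw [fA, fB, fa, fb, hc, hδ] at Ek
  rw [fB, fb4, fβ, hl] at E4
  clear fA fB fa fb fb4 fβ hl hc hδ hcl load2 load3 load23 hload load_le load4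
  generalize ∑ i, (if k ∈ ρ (.Jpart i) ∧ σ (.Jpart i) + p (.Jpart i) ≤ t then p (.Jpart i) else 0)
    = P at *
  generalize ∑ i, (if k ∈ ρ (.Jγ i) ∧ σ (.Jγ i) + p (.Jγ i) ≤ t then p (.Jγ i) else 0) = G at *
  generalize ∑ i : Fin (z+1), (if σ (.Jc i) + p (.Jc i) ≤ t then z + i.val else 0) = Sc at *
  generalize ∑ i : Fin z, (if k ∈ ρ (.Jγ i) ∧ σ (.Jγ i) + p (.Jγ i) ≤ t then 3*z - (i.val+1) else 0)
    = Sγ at *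
  generalize ∑ i : Fin z, (if k ∈ ρ (.Jδ i) ∧ σ (.Jδ i) + p (.Jδ i) ≤ t then 3*z - (i.val+1) else 0)
    = Sδ at *
  generalize (Finset.univ.filter fun i => k ∈ ρ (.Jγ i) ∧ σ (.Jγ i) + p (.Jγ i) ≤ t).card = nγ at *
  generalize (Finset.univ.filter fun i => k ∈ ρ (.Jδ i) ∧ σ (.Jδ i) + p (.Jδ i) ≤ t).card = nδ at *
  generalize (Finset.univ.filter fun i => k ∈ ρ (.Ja i) ∧ σ (.Ja i) + p (.Ja i) ≤ t).card = na at *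
  generalize (Finset.univ.filter fun i => k ∈ ρ (.Jb i) ∧ σ (.Jb i) + p (.Jb i) ≤ t).card = nb at *
  generalize (Finset.univ.filter fun i => σ (.Jb i) + p (.Jb i) ≤ t).card = nb4 at *
  generalize (Finset.univ.filter fun i => σ (.Jβ i) + p (.Jβ i) ≤ t).card = nβ at *
  generalize (Finset.univ.filter fun i => σ (.JA i) + p (.JA i) ≤ t).card = nA at *
  generalize (Finset.univ.filter fun i => σ (.JB i) + p (.JB i) ≤ t).card = nB at *
  generalize (Finset.univ.filter fun i => σ (.Jc i) + p (.Jc i) ≤ t).card = nc at *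
  generalize (if σ .Jl2 + p .Jl2 ≤ t then 1 else 0) = nl at *
  exact final_arith z D t (4*z-1) P G Sc Sγ Sδ nγ nδ na nb nb4 nβ nA nB nc nl hz hD (by omega)
    E4 Ek hγ hP gc gγ gδ cγ cδ ca cb cb4 cβ cA cl
end
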